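/- arXiv:2312.11077 — 2 statements merged into one kernel-verified Lean document; each statement's English description precedes it below -/
import Mathlib

section
/- Let (R, 𝔪) be a two-dimensional regular local ring with infinite residue field, 𝔪 = (x, y), and let I = (x, y^{m_1})(x, y^{m_2})⋯(x, y^{m_r}) where 2 ≤ m_1 ≤ m_2 ≤ ⋯ ≤ m_r and r ≥ 2. Then I = I(M) for an indecomposable integrally closed R-module M of rank r. -/
open IsLocalRing

section Defs

variable {R : Type*} [CommRing R]

/-- `R` is a two-dimensional regular local ring: Noetherian local of Krull dimension 2
whose maximal ideal is generated by two elements. -/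
def IsTwoDimRegularLocal (R : Type*) [CommRing R] [IsLocalRing R] : Prop :=
  IsNoetherianRing R ∧ ringKrullDim R = 2 ∧
    ∃ x y : R, maximalIdeal R = Ideal.span {x, y}

/-- `z` lies in the integral closure of the ideal `I`, i.e. it satisfies an equation
`z ^ n + c 1 * z ^ (n-1) + ⋯ + c n = 0` with `c i ∈ I ^ i`. -/
def MemIntClosure (I : Ideal R) (z : R) : Prop :=
  ∃ n : ℕ, 0 < n ∧ ∃ c : ℕ → R, (∀ i ∈ Finset.Icc 1 n, c i ∈ I ^ i) ∧
    z ^ n + ∑ i ∈ Finset.Icc 1 n, c i * z ^ (n - i) = 0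

/-- The ideal `I` is integrally closed. -/
def IdealIntClosed (I : Ideal R) : Prop := ∀ z, MemIntClosure I z → z ∈ I

/-- `I` is `𝔪`-primary. -/
def IsMPrimary [IsLocalRing R] (I : Ideal R) : Prop := I.radical = maximalIdeal R

/-- `ord I = n` : `n` is the largest power of the maximal ideal containing `I`. -/
def ordEQ [IsLocalRing R] (I : Ideal R) (n : ℕ) : Prop :=
  I ≤ maximalIdeal R ^ n ∧ ¬ I ≤ maximalIdeal R ^ (n + 1)

/-- Determinant of the square matrix with columns `w 0, …, w (r-1)`. -/
def colDet {r : ℕ} (w : Fin r → Fin r → R) : R :=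
  Matrix.det (Matrix.of fun i j => w j i)

/-- The ideal of maximal minors `I(M)` of a submodule `M ⊆ R^r`:  it is generated by all
determinants of `r × r` matrices whose columns lie in `M`. -/
def maxMinors {r : ℕ} (M : Submodule R (Fin r → R)) : Ideal R :=
  Ideal.span { d | ∃ w : Fin r → Fin r → R, (∀ j, w j ∈ M) ∧ d = colDet w }

/-- The ideal `I_k(M)` of `k × k` minors of a matrix whose columns generate `M ⊆ R^r`. -/
def minorsIdeal (k : ℕ) {r : ℕ} (M : Submodule R (Fin r → R)) : Ideal R :=
  Ideal.span { d | ∃ (w : Fin k → Fin r → R) (ρ : Fin k → Fin r),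
    Function.Injective ρ ∧ (∀ j, w j ∈ M) ∧
    d = Matrix.det (Matrix.of fun i j : Fin k => w j (ρ i)) }

/-- `v ∈ R^r` is integral over the submodule `M ⊆ R^r` : the determinant of every square
matrix with one column `v` and the remaining columns in `M` is integral over `I(M)`. -/
def IntegralOverMod {r : ℕ} (M : Submodule R (Fin r → R)) (v : Fin r → R) : Prop :=
  ∀ (w : Fin r → Fin r → R) (j₀ : Fin r), w j₀ = v → (∀ j, j ≠ j₀ → w j ∈ M) →
    MemIntClosure (maxMinors M) (colDet w)

/-- The submodule `M ⊆ R^r` is integrally closed. -/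
def ModIntClosed {r : ℕ} (M : Submodule R (Fin r → R)) : Prop :=
  ∀ v, IntegralOverMod M v → v ∈ M

/-- The length of an `R`-module, as the Krull dimension of its submodule lattice. -/
noncomputable def modLength (R : Type*) (M : Type*) [CommRing R] [AddCommGroup M]
    [Module R M] : WithBot ℕ∞ :=
  Order.krullDim (Submodule R M)

/-- `M ⊆ R^r` has finite colength; equivalently, `M` is a finitely generated torsion-free
module of rank `r` with double dual `M** = R^r`. -/
def FinColength {r : ℕ} (M : Submodule R (Fin r → R)) : Prop :=
  IsFiniteLength R ((Fin r → R) ⧸ M)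

/-- `M` has a nonzero free direct summand. -/
def HasFreeSummand {r : ℕ} (M : Submodule R (Fin r → R)) : Prop :=
  ∃ N P : Submodule R (Fin r → R), N ⊔ P = M ∧ N ⊓ P = ⊥ ∧ N ≠ ⊥ ∧ Module.Free R ↥N

/-- `M` is a direct sum of two nonzero submodules. -/
def DecomposableSub {r : ℕ} (M : Submodule R (Fin r → R)) : Prop :=
  ∃ N P : Submodule R (Fin r → R), N ⊔ P = M ∧ N ⊓ P = ⊥ ∧ N ≠ ⊥ ∧ P ≠ ⊥

/-- `M` is nonzero and not a direct sum of two nonzero submodules. -/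
def IndecomposableSub {r : ℕ} (M : Submodule R (Fin r → R)) : Prop :=
  M ≠ ⊥ ∧ ¬ DecomposableSub M

/-- `a` is a minimal generating set of the ideal `I`. -/
def MinGens {m : ℕ} (I : Ideal R) (a : Fin m → R) : Prop :=
  Ideal.span (Set.range a) = I ∧ ∀ j : Fin m, Ideal.span (a '' {j}ᶜ) ≠ I

/-- `a = c 0 * x^(r-1) + c 1 * x^(r-2) * y + ⋯ + c (r-1) * y^(r-1)`. -/
def Expresses (r : ℕ) (x y : R) (c : Fin r → R) (a : R) : Prop :=
  a = ∑ i : Fin r, c i * x ^ (r - 1 - (i : ℕ)) * y ^ (i : ℕ)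

/-- The `k`-th Koszul relation column between `x^(r-1), …, y^(r-1)`:
`y` in position `k` and `-x` in position `k+1`. -/
def stdRelCol (r : ℕ) (x y : R) (k : ℕ) : Fin r → R :=
  fun i => if (i : ℕ) = k then y else if (i : ℕ) = k + 1 then -x else 0

/-- The module generated by the coefficient columns `C j` together with the `r - 1`
Koszul relation columns between `x^(r-1), …, y^(r-1)`. -/
def MrSpan (r : ℕ) (x y : R) {m : ℕ} (C : Fin m → Fin r → R) :
    Submodule R (Fin r → R) :=
  Submodule.span R (Set.range C ∪ { v | ∃ k, k < r - 1 ∧ v = stdRelCol r x y k })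

/-- The data `(x, y, a, C)` presents the module `M_r(I)` : `𝔪 = (x,y)`, `a` is a minimal
generating set of `I` and column `C j` expresses `a j` in terms of `x^(r-1), …, y^(r-1)`. -/
def IsMrPresentation [IsLocalRing R] (r : ℕ) (I : Ideal R) {m : ℕ} (x y : R)
    (a : Fin m → R) (C : Fin m → Fin r → R) : Prop :=
  maximalIdeal R = Ideal.span {x, y} ∧ MinGens I a ∧ ∀ j, Expresses r x y (C j) (a j)

/-- `N` is a reduction of `M` : `N ≤ M` and every element of `M` is integral over `N`. -/
def IsReductionMod {r : ℕ} (N M : Submodule R (Fin r → R)) : Prop :=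
  N ≤ M ∧ ∀ v ∈ M, IntegralOverMod N v

/-- `N` is a minimal reduction of `M`. -/
def IsMinimalReductionMod {r : ℕ} (N M : Submodule R (Fin r → R)) : Prop :=
  IsReductionMod N M ∧ ∀ N' ≤ N, IsReductionMod N' M → N' = N

/-- The `j`-th signed maximal minor of an `r × (r+1)` matrix. -/
def signedMinor {r : ℕ} (A : Matrix (Fin r) (Fin (r + 1)) R) (j : Fin (r + 1)) : R :=
  (-1 : R) ^ (j : ℕ) * (A.submatrix id j.succAbove).det

/-- `M ⊆ R^r` is extremal: integrally closed, without free direct summands, with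
`λ(R/I(M)) = λ(R^r/M) + r(r-1)/2`. -/
def IsExtremal {r : ℕ} (M : Submodule R (Fin r → R)) : Prop :=
  FinColength M ∧ ModIntClosed M ∧ ¬ HasFreeSummand M ∧
    modLength R (R ⧸ maxMinors M) =
      modLength R ((Fin r → R) ⧸ M) + ((r * (r - 1) / 2 : ℕ) : WithBot ℕ∞)

/-- `a ∈ J`, `b ∈ K` is a joint reduction of the pair `(J, K)`. -/
def IsJointReduction (J K : Ideal R) (a b : R) : Prop :=
  a ∈ J ∧ b ∈ K ∧ ∃ n : ℕ,
    (Ideal.span {a} * K + Ideal.span {b} * J) * (J * K) ^ n = (J * K) ^ (n + 1)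

/-- `S` is the matrix `Sym^k(Q)` for `Q = [[a, c], [b, d]]` : with `X = aU + bV`,
`Y = cU + dV`, the `j`-th column of `S` records the coefficients of
`X^(k-j) Y^j` in terms of `U^k, U^(k-1)V, …, V^k`. -/
def IsSymOf (k : ℕ) (a b c d : R) (S : Matrix (Fin (k + 1)) (Fin (k + 1)) R) : Prop :=
  ∀ j : Fin (k + 1),
    ((MvPolynomial.C a * MvPolynomial.X 0 + MvPolynomial.C b * MvPolynomial.X 1) ^ (k - (j : ℕ)) *
        (MvPolynomial.C c * MvPolynomial.X 0 + MvPolynomial.C d * MvPolynomial.X 1) ^ (j : ℕ)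
      : MvPolynomial (Fin 2) R)
    = ∑ i : Fin (k + 1), MvPolynomial.C (S i j) *
        MvPolynomial.X 0 ^ (k - (i : ℕ)) * MvPolynomial.X 1 ^ (i : ℕ)

/-- The `r × s` bidiagonal matrix with `y` on the diagonal and `-x` directly below it. -/
def bidiag (r s : ℕ) (x y : R) : Matrix (Fin r) (Fin s) R :=
  Matrix.of fun i j =>
    if (i : ℕ) = (j : ℕ) then y else if (i : ℕ) = (j : ℕ) + 1 then -x else 0

end Defs

section RegularParameters

variable {R : Type*} [CommRing R] [IsLocalRing R]

theorem exists_prime_chain_of_ringKrullDim_eq_two (h : ringKrullDim R = 2) :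
    ∃ p q : Ideal R, p.IsPrime ∧ q.IsPrime ∧ p < q ∧ q < maximalIdeal R := by
  obtain ⟨l, hl⟩ := (Order.le_krullDim_iff (α := PrimeSpectrum R) (n := 2)).1 (by
    rw [ringKrullDim] at h; rw [h]; rfl)
  have h01 : l ⟨0, by omega⟩ < l ⟨1, by omega⟩ := l.strictMono (Fin.mk_lt_mk.2 one_pos)
  have h12 : l ⟨1, by omega⟩ < l ⟨2, by omega⟩ := l.strictMono (Fin.mk_lt_mk.2 one_lt_two)
  exact ⟨(l ⟨0, by omega⟩).asIdeal, (l ⟨1, by omega⟩).asIdeal, (l _).2, (l _).2, h01,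
    lt_of_lt_of_le h12 (IsLocalRing.le_maximalIdeal (l ⟨2, by omega⟩).2.ne_top)⟩

variable [IsNoetherianRing R] {x y : R}

theorem pow_notMem_sup_span_of_prime_chain (hm : maximalIdeal R = Ideal.span {x, y})
    {p q : Ideal R} [hp : p.IsPrime] [hq : q.IsPrime] (hpq : p < q) (hqm : q < maximalIdeal R)
    (n : ℕ) : x ^ n ∉ p ⊔ Ideal.span {y} := by
  intro hx
  have hy : y ∈ maximalIdeal R := hm ▸ Ideal.subset_span (by simp)
  set f := Ideal.Quotient.mk p with hf
  have hsurj : Function.Surjective f := Ideal.Quotient.mk_surjective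
  have hker : RingHom.ker f = p := Ideal.mk_ker
  have hpm : p ≤ maximalIdeal R := (hpq.trans hqm).le
  have hmp : ((maximalIdeal R).map f).IsPrime :=
    Ideal.map_isPrime_of_surjective hsurj (by rw [hker]; exact hpm)
  have hqp : (q.map f).IsPrime :=
    Ideal.map_isPrime_of_surjective hsurj (by rw [hker]; exact hpq.le)
  have hcm : ∀ {J : Ideal R}, p ≤ J → (J.map f).comap f = J := fun {J} hJ => by
    rw [Ideal.comap_map_of_surjective' f hsurj, hker, sup_eq_left.2 hJ]
  have hmin : (maximalIdeal R).map f ∈ (Ideal.span {f y}).minimalPrimes := by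
    refine ⟨⟨hmp, ?_⟩, ?_⟩
    · rw [Ideal.span_singleton_le_iff_mem]
      exact Ideal.mem_map_of_mem f hy
    · rintro J ⟨hJ, hJy⟩ -
      have hyJ : y ∈ J.comap f := hJy (Ideal.mem_span_singleton_self _)
      have hpJ : p ≤ J.comap f := hker.symm.le.trans (Ideal.ker_le_comap f)
      have hJp : (J.comap f).IsPrime := hJ.comap f
      have hxJ : x ∈ J.comap f := hJp.mem_of_pow_mem n
        (sup_le hpJ ((Ideal.span_singleton_le_iff_mem _).2 hyJ) hx)
      rw [Ideal.map_le_iff_le_comap, hm, Ideal.span_le]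
      rintro z (rfl | rfl)
      exacts [hxJ, hyJ]
  have h1 := Ideal.height_le_one_of_isPrincipal_of_mem_minimalPrimes (Ideal.span {f y}) _ hmin
  have hlt1 : (⊥ : Ideal (R ⧸ p)) < q.map f := by
    rw [bot_lt_iff_ne_bot]
    intro h
    rw [Ideal.map_eq_bot_iff_le_ker, hker] at h
    exact absurd hpq (not_lt_of_ge h)
  have hlt2 : q.map f < (maximalIdeal R).map f := by
    refine lt_of_le_of_ne (Ideal.map_mono hqm.le) fun h => hqm.ne ?_
    rw [← hcm hpq.le, h, hcm hpm]
  have hbp : (⊥ : Ideal (R ⧸ p)).IsPrime := Ideal.isPrime_bot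
  have h2 := Ideal.height_add_one_le_of_lt_of_isPrime hlt1
  have h3 := Ideal.height_add_one_le_of_lt_of_isPrime hlt2
  have h4 : (1 : ℕ∞) + 1 ≤ 1 :=
    ((add_le_add_left ((le_add_self).trans h2) 1).trans h3).trans h1
  exact absurd h4 (by decide)

/-- Krull's intersection theorem modulo `y`. -/
theorem exists_eq_unit_mul_pow_add (hm : maximalIdeal R = Ideal.span {x, y}) {z : R}
    (hz : ¬ y ∣ z) : ∃ (n : ℕ) (u w : R), IsUnit u ∧ z = u * x ^ n + y * w := by
  have hy : y ∈ maximalIdeal R := hm ▸ Ideal.subset_span (by simp)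
  have hne : Ideal.span {y} ≠ ⊤ := fun h => by
    rw [Ideal.span_singleton_eq_top] at h
    exact (IsLocalRing.mem_maximalIdeal _).1 hy h
  have : Nontrivial (R ⧸ Ideal.span {y}) := Ideal.Quotient.nontrivial_iff.2 hne
  have hloc : IsLocalRing (R ⧸ Ideal.span {y}) :=
    IsLocalRing.of_surjective' (Ideal.Quotient.mk (Ideal.span {y})) Ideal.Quotient.mk_surjective
  by_contra! hcon
  have key : ∀ n, ∃ a b, z = a * x ^ n + y * b := by
    intro n
    induction n with
    | zero => exact ⟨z, 0, by simp⟩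
    | succ n ih =>
      obtain ⟨a, b, hab⟩ := ih
      have ha : a ∈ maximalIdeal R := fun hu => hcon n a b hu hab
      rw [hm, Ideal.mem_span_pair] at ha
      obtain ⟨c, d, hcd⟩ := ha
      exact ⟨c, b + d * x ^ n, by rw [hab, ← hcd]; ring⟩
  have hI : Ideal.span {(Ideal.Quotient.mk (Ideal.span {y}) x)} ≠ ⊤ := by
    rw [Ne, Ideal.span_singleton_eq_top]
    intro hu
    obtain ⟨v, hv⟩ := hu.exists_right_inv
    obtain ⟨v, rfl⟩ := Ideal.Quotient.mk_surjective v
    rw [← map_mul, ← map_one (Ideal.Quotient.mk (Ideal.span {y})), Ideal.Quotient.eq] at hv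
    have h1 : x * v - 1 ∈ maximalIdeal R :=
      (Ideal.span_singleton_le_iff_mem _).2 hy hv
    have h2 : x * v ∈ maximalIdeal R :=
      Ideal.mul_mem_right _ _ (hm ▸ Ideal.subset_span (by simp))
    exact (IsLocalRing.mem_maximalIdeal (1 : R)).1 (by simpa using Ideal.sub_mem _ h2 h1) isUnit_one
  have h0 := Ideal.iInf_pow_eq_bot_of_isLocalRing _ hI
  apply hz
  rw [← Ideal.mem_span_singleton, ← Ideal.Quotient.eq_zero_iff_mem, ← Ideal.mem_bot, ← h0]
  refine (Submodule.mem_iInf _).2 fun n => ?_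
  obtain ⟨a, b, hab⟩ := key n
  rw [Ideal.span_singleton_pow, Ideal.mem_span_singleton, hab, map_add, map_mul, map_mul, map_pow,
    Ideal.Quotient.eq_zero_iff_mem.2 (Ideal.mem_span_singleton_self y)]
  simp

theorem isDomain_and_prime_of_maximalIdeal_eq_span_pair (hdim : ringKrullDim R = 2)
    (hm : maximalIdeal R = Ideal.span {x, y}) : IsDomain R ∧ Prime y ∧ ¬ y ∣ x := by
  obtain ⟨p, q, hp, hq, hpq, hqm⟩ := exists_prime_chain_of_ringKrullDim_eq_two hdim
  have hy : y ∈ maximalIdeal R := hm ▸ Ideal.subset_span (by simp)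
  have hpow := pow_notMem_sup_span_of_prime_chain hm hpq hqm
  have hxq : x ∉ p := fun h => hpow 1 (by rw [pow_one]; exact Ideal.mem_sup_left h)
  have hple : ∀ z ∈ p, y ∣ z := by
    intro z hz
    by_contra hyz
    obtain ⟨n, u, w, hu, rfl⟩ := exists_eq_unit_mul_pow_add hm hyz
    apply hpow n
    rw [← Ideal.unit_mul_mem_iff_mem _ hu, ← Ideal.add_mem_iff_left _
      (Ideal.mul_mem_right w _ (Ideal.mem_sup_right (Ideal.mem_span_singleton_self y)))]
    exact Ideal.mem_sup_left hz
  have hyp : y ∉ p := by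
    intro hyp
    obtain ⟨z, hzq, hzp⟩ := Set.exists_of_ssubset hpq
    have hyz : ¬ y ∣ z := fun h => hzp (Ideal.mem_of_dvd _ h hyp)
    obtain ⟨n, u, w, hu, rfl⟩ := exists_eq_unit_mul_pow_add hm hyz
    have h1 : u * x ^ n ∈ q := (Ideal.add_mem_iff_left _ (q.mul_mem_right _ (hpq.le hyp))).1 hzq
    have h2 : x ∈ q := hq.mem_of_pow_mem n ((Ideal.unit_mul_mem_iff_mem _ hu).1 h1)
    refine not_lt_of_ge ?_ hqm
    rw [hm, Ideal.span_le]
    rintro t (rfl | rfl)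
    exacts [h2, hpq.le hyp]
  have hbot : p = ⊥ := by
    refine Submodule.eq_bot_of_le_smul_of_le_jacobson_bot (maximalIdeal R) p
      (IsNoetherian.noetherian p) (fun z hz => ?_) (IsLocalRing.maximalIdeal_le_jacobson _)
    obtain ⟨b, rfl⟩ := hple z hz
    exact Submodule.smul_mem_smul hy ((hp.mem_or_mem hz).resolve_left hyp)
  subst hbot
  have hdom : IsDomain R := IsDomain.of_bot_isPrime R
  refine ⟨hdom, ⟨fun h => hyp (by simp [h]), (IsLocalRing.mem_maximalIdeal _).1 hy, ?_⟩, ?_⟩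
  · intro a b hab
    by_contra! hcon
    obtain ⟨n, u, w, hu, rfl⟩ := exists_eq_unit_mul_pow_add hm hcon.1
    obtain ⟨n', u', w', hu', rfl⟩ := exists_eq_unit_mul_pow_add hm hcon.2
    obtain ⟨c, hc⟩ := hab
    apply hpow (n + n')
    rw [bot_sup_eq, ← Ideal.unit_mul_mem_iff_mem _ (hu.mul hu'), Ideal.mem_span_singleton]
    exact ⟨c - u * x ^ n * w' - w * (u' * x ^ n' + y * w'), by linear_combination hc⟩
  · intro h
    exact hpow 1 (by rw [pow_one, bot_sup_eq, Ideal.mem_span_singleton]; exact h)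

end RegularParameters

/-- `x, y` generate the maximal ideal and each is prime and does not divide the other. -/
structure IsRegularPair {R : Type*} [CommRing R] [IsLocalRing R] (x y : R) : Prop where
  maximalIdeal_eq : maximalIdeal R = Ideal.span {x, y}
  prime_left : Prime x
  prime_right : Prime y
  not_left_dvd : ¬ x ∣ y
  not_right_dvd : ¬ y ∣ x

section Chart

open Polynomial

noncomputable section

/-- The affine chart `R[x / y ^ q]` of the blow-up of `(x, y ^ q)`. -/
def BlowupChart {R : Type*} [CommRing R] (x y : R) (q : ℕ) : Type _ :=
  R[X] ⧸ Ideal.span {X * C (y ^ q) - C x}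

instance {R : Type*} [CommRing R] (x y : R) (q : ℕ) : CommRing (BlowupChart x y q) :=
  inferInstanceAs (CommRing (R[X] ⧸ Ideal.span {X * C (y ^ q) - C x}))

/-- The presentation of the chart as a quotient of a polynomial ring. -/
def chartMk {R : Type*} [CommRing R] (x y : R) (q : ℕ) : R[X] →+* BlowupChart x y q :=
  Ideal.Quotient.mk _

/-- The structure map of the chart. -/
def toChart {R : Type*} [CommRing R] (x y : R) (q : ℕ) : R →+* BlowupChart x y q :=
  (chartMk x y q).comp C

/-- The elements of `R` that are divisible by `y ^ n` in the chart `R[x / y ^ q]`. -/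
def chartIdeal {R : Type*} [CommRing R] (x y : R) (q n : ℕ) : Ideal R :=
  (Ideal.span {toChart x y q y ^ n}).comap (toChart x y q)

/-- The class of `x / y ^ q` in the chart. -/
def chartVar {R : Type*} [CommRing R] (x y : R) (q : ℕ) : BlowupChart x y q := chartMk x y q X

end

variable {R : Type*} [CommRing R] {x y : R} {q : ℕ}

theorem chartMk_surjective : Function.Surjective (chartMk x y q) :=
  Ideal.Quotient.mk_surjective

theorem chartMk_eq_zero_iff {p : R[X]} : chartMk x y q p = 0 ↔ X * C (y ^ q) - C x ∣ p :=
  Ideal.Quotient.eq_zero_iff_mem.trans Ideal.mem_span_singleton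

theorem chartVar_mul_pow :
    chartVar x y q * toChart x y q y ^ q = toChart x y q x := by
  rw [← map_pow]
  exact Ideal.Quotient.eq.2 (Ideal.mem_span_singleton_self _)

theorem mem_chartIdeal {n : ℕ} {z : R} : z ∈ chartIdeal x y q n ↔
    toChart x y q y ^ n ∣ toChart x y q z := by
  rw [chartIdeal, Ideal.mem_comap, Ideal.mem_span_singleton]

theorem chartIdeal_mul_le (n k : ℕ) :
    chartIdeal x y q n * chartIdeal x y q k ≤ chartIdeal x y q (n + k) := by
  refine Ideal.mul_le.2 fun a ha b hb => ?_
  rw [mem_chartIdeal] at *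
  rw [pow_add, map_mul]
  exact mul_dvd_mul ha hb

theorem chartIdeal_zero : chartIdeal x y q 0 = ⊤ :=
  (Ideal.eq_top_iff_one _).2 (mem_chartIdeal.2 (by simp))

theorem chartIdeal_anti {n k : ℕ} (h : n ≤ k) : chartIdeal x y q k ≤ chartIdeal x y q n :=
  fun _ hz => mem_chartIdeal.2 ((pow_dvd_pow _ h).trans (mem_chartIdeal.1 hz))

theorem pow_le_chartIdeal {I : Ideal R} {n : ℕ} (h : I ≤ chartIdeal x y q n) (k : ℕ) :
    I ^ k ≤ chartIdeal x y q (n * k) := by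
  induction k with
  | zero => simp [chartIdeal_zero]
  | succ k ih =>
    rw [pow_succ, mul_add, mul_one]
    exact (Ideal.mul_mono ih h).trans (chartIdeal_mul_le _ _)

theorem prod_le_chartIdeal {ι : Type*} (s : Finset ι) (J : ι → Ideal R) (n : ι → ℕ)
    (h : ∀ i ∈ s, J i ≤ chartIdeal x y q (n i)) :
    ∏ i ∈ s, J i ≤ chartIdeal x y q (∑ i ∈ s, n i) := by
  classical
  induction s using Finset.induction_on with
  | empty => simp [chartIdeal_zero]
  | insert a s ha ih =>
    rw [Finset.prod_insert ha, Finset.sum_insert ha]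
    exact (Ideal.mul_mono (h a (by simp)) (ih fun i hi => h i (by simp [hi]))).trans
      (chartIdeal_mul_le _ _)

theorem left_mem_chartIdeal : x ∈ chartIdeal x y q q :=
  mem_chartIdeal.2 (chartVar_mul_pow (x := x) (y := y) (q := q) ▸ dvd_mul_left _ _)

theorem right_pow_mem_chartIdeal (n : ℕ) : y ^ n ∈ chartIdeal x y q n :=
  mem_chartIdeal.2 (by rw [map_pow])

theorem span_pair_le_chartIdeal (k : ℕ) :
    Ideal.span {x, y ^ k} ≤ chartIdeal x y q (min q k) := by
  rw [Ideal.span_le]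
  rintro z (rfl | rfl)
  · exact chartIdeal_anti (min_le_left _ _) left_mem_chartIdeal
  · exact chartIdeal_anti (min_le_right _ _) (right_pow_mem_chartIdeal k)

theorem chartIdeal_le_span_pair (n : ℕ) :
    chartIdeal x y q n ≤ Ideal.span {x, y ^ n} := by
  intro z hz
  let f : BlowupChart x y q →+* R ⧸ Ideal.span {x} :=
    Ideal.Quotient.lift _ (eval₂RingHom (Ideal.Quotient.mk _) 0) (by
      intro a ha
      obtain ⟨b, rfl⟩ := Ideal.mem_span_singleton.1 ha
      have : Ideal.Quotient.mk (Ideal.span {x}) x = 0 :=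
        Ideal.Quotient.eq_zero_iff_mem.2 (Ideal.mem_span_singleton_self x)
      simp [this])
  have hf : ∀ a : R, f (toChart x y q a) = Ideal.Quotient.mk _ a := fun a => by
    exact eval₂_C _ _
  obtain ⟨b, hb⟩ := mem_chartIdeal.1 hz
  have h := congrArg f hb
  obtain ⟨c, hc⟩ := Ideal.Quotient.mk_surjective (f b)
  rw [map_mul, map_pow, hf, hf, ← hc, ← map_pow, ← map_mul, Ideal.Quotient.eq,
    Ideal.mem_span_singleton] at h
  obtain ⟨d, hd⟩ := h
  exact Ideal.mem_span_pair.2 ⟨d, c, by linear_combination -hd⟩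

section Local

variable [IsLocalRing R]

theorem IsRegularPair.residue_eq_zero (h : IsRegularPair x y) :
    residue R x = 0 ∧ residue R y = 0 := by
  simp_rw [residue_eq_zero_iff, h.maximalIdeal_eq]
  exact ⟨Ideal.subset_span (by simp), Ideal.subset_span (by simp)⟩

/-- The reduction of the chart modulo `y`, a polynomial ring over the residue field. -/
noncomputable def chartReduction (h : IsRegularPair x y) (hq : 1 ≤ q) :
    BlowupChart x y q →+* (ResidueField R)[X] :=
  Ideal.Quotient.lift _ (mapRingHom (residue R)) (by
    intro a ha
    obtain ⟨b, rfl⟩ := Ideal.mem_span_singleton.1 ha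
    have hq0 : q ≠ 0 := by omega
    simp [h.residue_eq_zero.1, h.residue_eq_zero.2, hq0])

theorem chartReduction_mk (h : IsRegularPair x y) (hq : 1 ≤ q) (p : R[X]) :
    chartReduction h hq (chartMk x y q p) = p.map (residue R) := rfl

theorem chartReduction_toChart (h : IsRegularPair x y) (hq : 1 ≤ q) (a : R) :
    chartReduction h hq (toChart x y q a) = C (residue R a) :=
  (chartReduction_mk h hq (C a)).trans (map_C _)

theorem chartReduction_chartVar (h : IsRegularPair x y) (hq : 1 ≤ q) :
    chartReduction h hq (chartVar x y q) = X :=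
  (chartReduction_mk h hq X).trans (map_X _)

theorem chartReduction_eq_zero_iff (h : IsRegularPair x y) (hq : 1 ≤ q) {a : BlowupChart x y q} :
    chartReduction h hq a = 0 ↔ toChart x y q y ∣ a := by
  constructor
  · obtain ⟨p, rfl⟩ := chartMk_surjective a
    rw [chartReduction_mk]
    intro hp
    rw [p.as_sum_range_C_mul_X_pow, map_sum]
    refine Finset.dvd_sum fun i _ => ?_
    have hi : p.coeff i ∈ maximalIdeal R := by
      rw [← residue_eq_zero_iff, ← coeff_map, hp, coeff_zero]
    rw [h.maximalIdeal_eq, Ideal.mem_span_pair] at hi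
    obtain ⟨c, d, hcd⟩ := hi
    have hy : toChart x y q y ∣ toChart x y q (p.coeff i) := by
      rw [← hcd, map_add, map_mul, map_mul, ← chartVar_mul_pow (x := x) (y := y) (q := q)]
      exact dvd_add (((dvd_pow_self _ (by omega)).mul_left _).mul_left _) (dvd_mul_left _ _)
    rw [map_mul]
    exact Dvd.dvd.mul_right hy _
  · rintro ⟨b, rfl⟩
    rw [map_mul, chartReduction_toChart, h.residue_eq_zero.2, C_0, zero_mul]

variable [IsDomain R]

theorem eq_zero_of_toChart_mul_eq_zero (h : IsRegularPair x y) (hq : 1 ≤ q) {a : BlowupChart x y q}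
    (ha : toChart x y q y * a = 0) : a = 0 := by
  obtain ⟨p, rfl⟩ := chartMk_surjective a
  rw [toChart, RingHom.comp_apply, ← map_mul, chartMk_eq_zero_iff] at ha
  obtain ⟨g, hg⟩ := ha
  obtain ⟨k, rfl⟩ := Nat.exists_eq_add_of_le' hq
  have hCy : Prime (C y : R[X]) := prime_C_iff.2 h.prime_right
  have hdvd : C y ∣ C x * g :=
    ⟨X * C (y ^ k) * g - p, by rw [pow_succ, C_mul] at hg; linear_combination hg⟩
  obtain ⟨g', rfl⟩ := (hCy.dvd_or_dvd hdvd).resolve_left fun hd => by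
    obtain ⟨c, hc⟩ := hd
    exact h.not_right_dvd ⟨c.coeff 0, by simpa using congrArg (coeff · 0) hc⟩
  exact chartMk_eq_zero_iff.2 ⟨g', mul_left_cancel₀ hCy.ne_zero (by linear_combination hg)⟩

theorem toChart_pow_mul_cancel (h : IsRegularPair x y) (hq : 1 ≤ q) (n : ℕ)
    {a b : BlowupChart x y q}
    (hab : toChart x y q y ^ n * a = toChart x y q y ^ n * b) : a = b := by
  induction n with
  | zero => simpa using hab
  | succ n ih =>
    refine ih (sub_eq_zero.1 (eq_zero_of_toChart_mul_eq_zero h hq ?_))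
    linear_combination hab

theorem pow_mul_mem_chartIdeal (h : IsRegularPair x y) (hq : 1 ≤ q) {s n : ℕ} {z : R}
    (hz : y ^ s * z ∈ chartIdeal x y q (n + s)) : z ∈ chartIdeal x y q n := by
  rw [mem_chartIdeal] at *
  obtain ⟨b, hb⟩ := hz
  refine ⟨b, toChart_pow_mul_cancel h hq s ?_⟩
  rw [map_mul, map_pow] at hb
  rw [hb]; ring

theorem pow_dvd_of_pow_dvd_chartVar_mul (h : IsRegularPair x y) (hq : 1 ≤ q) {n : ℕ}
    {a : BlowupChart x y q} (ha : toChart x y q y ^ n ∣ chartVar x y q * a) :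
    toChart x y q y ^ n ∣ a := by
  induction n generalizing a with
  | zero => simp
  | succ n ih =>
    have h1 := (dvd_pow_self _ n.succ_ne_zero).trans ha
    rw [← chartReduction_eq_zero_iff h hq, map_mul, chartReduction_chartVar] at h1
    obtain ⟨b, rfl⟩ := (chartReduction_eq_zero_iff h hq).1
      (eq_zero_of_ne_zero_of_mul_left_eq_zero X_ne_zero h1)
    obtain ⟨c, hc⟩ := ha
    rw [pow_succ']
    refine mul_dvd_mul_left _ (ih ⟨c, toChart_pow_mul_cancel h hq 1 ?_⟩)
    linear_combination hc

theorem left_mul_mem_chartIdeal (h : IsRegularPair x y) (hq : 1 ≤ q) {n : ℕ} {z : R}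
    (hz : x * z ∈ chartIdeal x y q (n + q)) : z ∈ chartIdeal x y q n := by
  rw [mem_chartIdeal] at *
  obtain ⟨b, hb⟩ := hz
  rw [map_mul, ← chartVar_mul_pow (x := x) (y := y) (q := q)] at hb
  exact pow_dvd_of_pow_dvd_chartVar_mul h hq ⟨b,
    toChart_pow_mul_cancel h hq q (by linear_combination hb)⟩

/-- The `y`-adic filtration of the chart is given by a valuation, so its contraction consists of
integrally closed ideals. -/
theorem mem_chartIdeal_of_memIntClosure (h : IsRegularPair x y) (hq : 1 ≤ q) {I : Ideal R} {N : ℕ}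
    (hI : I ≤ chartIdeal x y q N) {z : R} (hz : MemIntClosure I z) : z ∈ chartIdeal x y q N := by
  obtain ⟨k, hk, c, hc, heq⟩ := hz
  suffices ∀ n ≤ N, z ∈ chartIdeal x y q n from this N le_rfl
  intro n
  induction n with
  | zero => simp [chartIdeal_zero]
  | succ n ih =>
    intro hn
    have hzn := ih (by omega)
    have hsum : z ^ k ∈ chartIdeal x y q (n * k + 1) := by
      rw [eq_neg_of_add_eq_zero_left heq]
      refine neg_mem (sum_mem fun i hi => ?_)
      have hi' := Finset.mem_Icc.1 hi
      have h1 := pow_le_chartIdeal hI i (hc i hi)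
      have h2 := pow_le_chartIdeal ((Ideal.span_singleton_le_iff_mem _).2 hzn) (k - i)
        (Ideal.pow_mem_pow (Ideal.mem_span_singleton_self z) _)
      refine chartIdeal_anti ?_ (chartIdeal_mul_le _ _ (Ideal.mul_mem_mul h1 h2))
      obtain ⟨j, rfl⟩ := Nat.exists_eq_add_of_le hi'.2
      have : (n + 1) * i ≤ N * i := Nat.mul_le_mul_right i hn
      rw [Nat.add_sub_cancel_left]
      nlinarith [hi'.1]
    rw [mem_chartIdeal] at *
    obtain ⟨b, hb⟩ := hzn
    have hyb : toChart x y q y ∣ b ^ k := by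
      obtain ⟨d, hd⟩ := hsum
      refine ⟨d, toChart_pow_mul_cancel h hq (n * k) ?_⟩
      rw [map_pow, hb, mul_pow, ← pow_mul] at hd
      rw [hd]; ring
    have hyb' : toChart x y q y ∣ b := by
      rw [← chartReduction_eq_zero_iff h hq, map_pow] at hyb
      exact (chartReduction_eq_zero_iff h hq).1 (pow_eq_zero_iff (by omega) |>.1 hyb)
    rw [hb, pow_succ]
    exact mul_dvd_mul_left _ hyb'

end Local

end Chart

section MonomialIdeals

variable {R : Type*} [CommRing R] {x y : R}

theorem left_pow_mem_prod_span_pair {n : ℕ} (m : Fin n → ℕ) :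
    x ^ n ∈ ∏ i, Ideal.span {x, y ^ m i} := by
  simpa using Ideal.prod_mem_prod (s := Finset.univ) (I := fun i => Ideal.span {x, y ^ m i})
    (x := fun _ => x) fun i _ => Ideal.subset_span (by simp)

theorem right_pow_mem_prod_span_pair {n : ℕ} (m : Fin n → ℕ) :
    y ^ (∑ i, m i) ∈ ∏ i, Ideal.span {x, y ^ m i} := by
  rw [← Finset.prod_pow_eq_pow_sum]
  exact Ideal.prod_mem_prod fun i _ => Ideal.subset_span (by simp)

theorem prod_span_pair_le_chartIdeal {n : ℕ} (m : Fin n → ℕ) (q : ℕ) :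
    ∏ i, Ideal.span {x, y ^ m i} ≤ chartIdeal x y q (∑ i, min q (m i)) :=
  prod_le_chartIdeal _ _ _ fun i _ => span_pair_le_chartIdeal (m i)

theorem prod_span_pair_le_pow {n : ℕ} (m : Fin n → ℕ) (hm : ∀ i, 1 ≤ m i) :
    ∏ i, Ideal.span {x, y ^ m i} ≤ Ideal.span {x, y} ^ n := by
  induction n with
  | zero => simp
  | succ n ih =>
    rw [Fin.prod_univ_castSucc, pow_succ]
    refine Ideal.mul_mono (ih _ fun i => hm _) ?_
    rw [Ideal.span_le]
    rintro z (rfl | rfl)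
    · exact Ideal.subset_span (by simp)
    · exact Ideal.pow_mem_of_mem _ (Ideal.subset_span (by simp)) _ (hm _)

variable [IsLocalRing R] [IsDomain R]

theorem mem_prod_span_pair_of_mem_chartIdeal (h : IsRegularPair x y) {n : ℕ} (m : Fin n → ℕ)
    (hmono : Monotone m) (hm : ∀ i, 1 ≤ m i) {z : R}
    (hz : ∀ i, z ∈ chartIdeal x y (m i) (∑ j, min (m i) (m j))) :
    z ∈ ∏ i, Ideal.span {x, y ^ m i} := by
  induction n generalizing z with
  | zero => simp
  | succ n ih =>
    have hlast := hz (Fin.last n)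
    rw [Finset.sum_congr rfl fun j _ => min_eq_right (hmono (Fin.le_last j))] at hlast
    obtain ⟨a, b, rfl⟩ := Ideal.mem_span_pair.1 (chartIdeal_le_span_pair _ hlast)
    have hy := right_pow_mem_prod_span_pair (x := x) (y := y) m
    refine Ideal.add_mem _ ?_ (Ideal.mul_mem_left _ _ hy)
    have ha : a ∈ ∏ i : Fin n, Ideal.span {x, y ^ m i.castSucc} := by
      refine ih (fun i => m i.castSucc) (fun i j hij => hmono (Fin.castSucc_le_castSucc_iff.2 hij))
        (fun i => hm _) fun i => ?_
      have hi := hz i.castSucc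
      rw [Ideal.add_mem_iff_left _
        (Ideal.mul_mem_left _ _ (prod_span_pair_le_chartIdeal m (m i.castSucc) hy)),
        Fin.sum_univ_castSucc, min_eq_left (hmono (Fin.le_last i.castSucc)), mul_comm] at hi
      exact left_mul_mem_chartIdeal h (hm _) hi
    rw [Fin.prod_univ_castSucc]
    exact Ideal.mul_mem_mul ha (Ideal.subset_span (by simp))

theorem idealIntClosed_prod_span_pair (h : IsRegularPair x y) {n : ℕ} (m : Fin n → ℕ)
    (hmono : Monotone m) (hm : ∀ i, 1 ≤ m i) :
    IdealIntClosed (∏ i, Ideal.span {x, y ^ m i}) := fun _ hz =>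
  mem_prod_span_pair_of_mem_chartIdeal h m hmono hm fun i =>
    mem_chartIdeal_of_memIntClosure h (hm i) (prod_span_pair_le_chartIdeal m (m i)) hz

end MonomialIdeals

section MonomialForm

variable {R : Type*} [CommRing R] {s : ℕ}

/-- The linear form `v ↦ v 0 * x ^ s + v 1 * x ^ (s - 1) * y + ⋯ + v s * y ^ s`. -/
def monomialForm (s : ℕ) (x y : R) : (Fin (s + 1) → R) →ₗ[R] R :=
  Fintype.linearCombination R fun i => x ^ (s - (i : ℕ)) * y ^ (i : ℕ)

theorem monomialForm_apply (x y : R) (v : Fin (s + 1) → R) :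
    monomialForm s x y v = ∑ i, v i * (x ^ (s - (i : ℕ)) * y ^ (i : ℕ)) := by
  simp [monomialForm, Fintype.linearCombination_apply]

theorem monomialForm_single (x y : R) (i : Fin (s + 1)) (a : R) :
    monomialForm s x y (Pi.single i a) = a * (x ^ (s - (i : ℕ)) * y ^ (i : ℕ)) := by
  simp [monomialForm, Fintype.linearCombination_apply_single]

theorem stdRelCol_eq (x y : R) (k : Fin s) :
    stdRelCol (s + 1) x y k = y • Pi.single k.castSucc 1 - x • Pi.single k.succ 1 := by
  funext i
  simp only [stdRelCol, Pi.sub_apply, Pi.smul_apply, Pi.single_apply, Fin.ext_iff, Fin.val_succ,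
    Fin.val_castSucc, smul_eq_mul]
  split_ifs <;> first | omega | simp

theorem monomialForm_stdRelCol (x y : R) (k : Fin s) :
    monomialForm s x y (stdRelCol (s + 1) x y k) = 0 := by
  rw [stdRelCol_eq, map_sub, map_smul, map_smul, monomialForm_single, monomialForm_single]
  obtain ⟨j, hj⟩ := Nat.exists_eq_add_of_lt k.2
  have h1 : s - (k : ℕ) = j + 1 := by omega
  have h2 : s - ((k : ℕ) + 1) = j := by omega
  simp only [Fin.val_castSucc, Fin.val_succ, h1, h2, smul_eq_mul]
  ring

theorem span_pair_pow_le_range_monomialForm (x y : R) :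
    Ideal.span {x, y} ^ s ≤ LinearMap.range (monomialForm s x y) := by
  induction s with
  | zero => exact fun z _ => ⟨fun _ => z, by simp [monomialForm_apply]⟩
  | succ s ih =>
    rw [pow_succ]
    refine Ideal.mul_le.2 fun a ha b hb => ?_
    obtain ⟨v, rfl⟩ := ih ha
    obtain ⟨c, d, rfl⟩ := Ideal.mem_span_pair.1 hb
    refine ⟨c • Fin.snoc (α := fun _ => R) v 0 + d • Fin.cons (α := fun _ => R) 0 v, ?_⟩
    have h1 : monomialForm (s + 1) x y (Fin.snoc (α := fun _ => R) v 0) =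
        x * monomialForm s x y v := by
      rw [monomialForm_apply, monomialForm_apply, Fin.sum_univ_castSucc, Finset.mul_sum]
      simp only [Fin.snoc_castSucc, Fin.snoc_last, Fin.val_castSucc, zero_mul, add_zero]
      refine Finset.sum_congr rfl fun i _ => ?_
      rw [Nat.succ_sub (by omega), pow_succ]
      ring
    have h2 : monomialForm (s + 1) x y (Fin.cons (α := fun _ => R) 0 v) =
        y * monomialForm s x y v := by
      rw [monomialForm_apply, monomialForm_apply, Fin.sum_univ_succ, Finset.mul_sum]
      simp only [Fin.cons_succ, Fin.cons_zero, Fin.val_succ, zero_mul, zero_add]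
      refine Finset.sum_congr rfl fun i _ => ?_
      rw [Nat.add_sub_add_right, pow_succ]
      ring
    rw [map_add, map_smul, map_smul, h1, h2, smul_eq_mul, smul_eq_mul]
    ring

/-- Cramer's rule for the row of monomials of degree `s`. -/
theorem monomial_mul_colDet (x y : R) (w : Fin (s + 1) → Fin (s + 1) → R) (i : Fin (s + 1)) :
    x ^ (s - (i : ℕ)) * y ^ (i : ℕ) * colDet w =
      ∑ j, monomialForm s x y (w j) * (Matrix.of fun i j => w j i).adjugate j i := by
  set A : Matrix (Fin (s + 1)) (Fin (s + 1)) R := Matrix.of fun i j => w j i with hA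
  set c : Fin (s + 1) → R := fun i => x ^ (s - (i : ℕ)) * y ^ (i : ℕ) with hc
  have h1 : Matrix.vecMul (Matrix.vecMul c A) A.adjugate = A.det • c := by
    rw [Matrix.vecMul_vecMul, Matrix.mul_adjugate, Matrix.vecMul_smul, Matrix.vecMul_one]
  have h2 := congrFun h1 i
  have h3 : Matrix.vecMul c A = fun j => monomialForm s x y (w j) := by
    funext j
    rw [monomialForm_apply]
    simp only [Matrix.vecMul, dotProduct, hA, hc, Matrix.of_apply]
    exact Finset.sum_congr rfl fun k _ => mul_comm _ _
  rw [h3] at h2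
  calc c i * colDet w = (A.det • c) i := mul_comm (c i) A.det
    _ = _ := h2.symm

theorem colDet_cons_stdRelCol [IsDomain R] {x y : R} (hy : y ≠ 0) (v : Fin (s + 1) → R) :
    colDet (Fin.cons v fun k : Fin s => stdRelCol (s + 1) x y k) =
      (-1) ^ s * monomialForm s x y v := by
  have h := monomial_mul_colDet x y
    (Fin.cons v fun k : Fin s => stdRelCol (s + 1) x y k) (Fin.last s)
  rw [Fin.sum_univ_succ] at h
  simp only [Fin.cons_zero, Fin.cons_succ, monomialForm_stdRelCol, zero_mul,
    Finset.sum_const_zero, add_zero, Fin.val_last, Nat.sub_self, pow_zero, one_mul] at h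
  rw [Matrix.adjugate_fin_succ_eq_det_submatrix, Matrix.det_of_isLowerTriangular] at h
  · simp [stdRelCol] at h
    refine mul_left_cancel₀ (pow_ne_zero s hy) ?_
    rw [h]; ring
  · intro i j hij
    have : (i : ℕ) < j := hij
    simp [stdRelCol, show (i : ℕ) ≠ j by omega, show (i : ℕ) ≠ j + 1 by omega]

theorem det_mem_chartIdeal {x y : R} {q n : ℕ} (A : Matrix (Fin n) (Fin n) R)
    (hA : ∀ i j, A i j ∈ chartIdeal x y q 1) : A.det ∈ chartIdeal x y q n := by
  rw [Matrix.det_apply]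
  refine sum_mem fun σ _ => Submodule.smul_of_tower_mem _ _ ?_
  have h := prod_le_chartIdeal (x := x) (y := y) (q := q) Finset.univ
    (fun _ : Fin n => chartIdeal x y q 1) (fun _ => 1) (fun _ _ => le_rfl)
    (Ideal.prod_mem_prod (x := fun i => A (σ i) i) fun i _ => hA _ _)
  simpa using h

end MonomialForm

section SymbolForm

open Polynomial

variable {R : Type*} [CommRing R] {x y : R} {s : ℕ}

/-- The class of `monomialForm s x y v / y ^ s` in the chart `R[x / y]`. -/
noncomputable def chartForm (s : ℕ) (x y : R) (v : Fin (s + 1) → R) : BlowupChart x y 1 :=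
  ∑ i, toChart x y 1 (v i) * chartVar x y 1 ^ (s - (i : ℕ))

theorem toChart_left : toChart x y 1 x = chartVar x y 1 * toChart x y 1 y := by
  rw [← chartVar_mul_pow (x := x) (y := y) (q := 1), pow_one]

theorem toChart_monomialForm (v : Fin (s + 1) → R) :
    toChart x y 1 (monomialForm s x y v) = toChart x y 1 y ^ s * chartForm s x y v := by
  rw [monomialForm_apply, chartForm, map_sum, Finset.mul_sum]
  refine Finset.sum_congr rfl fun i _ => ?_
  obtain ⟨j, hj⟩ := Nat.exists_eq_add_of_le (Nat.le_of_lt_succ i.2)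
  have h1 : s - (i : ℕ) = j := by omega
  have h2 : toChart x y 1 y ^ s = toChart x y 1 y ^ (i : ℕ) * toChart x y 1 y ^ j := by
    rw [← pow_add, ← hj]
  rw [h1, map_mul, map_mul, map_pow, map_pow, toChart_left, h2]
  ring

variable [IsLocalRing R]

theorem coeff_chartReduction_chartForm (h : IsRegularPair x y) (v : Fin (s + 1) → R)
    (i : Fin (s + 1)) :
    (chartReduction h le_rfl (chartForm s x y v)).coeff (s - (i : ℕ)) = residue R (v i) := by
  simp only [chartForm, map_sum, map_mul, map_pow, chartReduction_toChart,
    chartReduction_chartVar, finsetSum_coeff, coeff_C_mul, coeff_X_pow]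
  rw [Finset.sum_eq_single i]
  · simp
  · intro j _ hji
    rw [if_neg, mul_zero]
    intro hij
    exact hji (Fin.ext (by omega))
  · simp

variable [IsDomain R]

theorem mem_maximalIdeal_of_monomialForm_mem (h : IsRegularPair x y) {v : Fin (s + 1) → R}
    (hv : monomialForm s x y v ∈ chartIdeal x y 1 (s + 1)) (i : Fin (s + 1)) :
    v i ∈ maximalIdeal R := by
  rw [← residue_eq_zero_iff, ← coeff_chartReduction_chartForm h v i]
  obtain ⟨b, hb⟩ := mem_chartIdeal.1 hv
  rw [toChart_monomialForm] at hb
  have hdvd : toChart x y 1 y ∣ chartForm s x y v :=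
    ⟨b, toChart_pow_mul_cancel h le_rfl s (by rw [hb]; ring)⟩
  rw [(chartReduction_eq_zero_iff h le_rfl).2 hdvd, coeff_zero]

omit [IsLocalRing R] [IsDomain R] in
theorem toChart_mem_of_mem_prod_span_pair {n : ℕ} (m : Fin n → ℕ) (hm : ∀ i, 2 ≤ m i) {z : R}
    (hz : z ∈ ∏ i, Ideal.span {x, y ^ m i}) :
    ∃ a b, toChart x y 1 z = toChart x y 1 y ^ n *
      (chartVar x y 1 ^ n * a + toChart x y 1 y * b) := by
  induction n generalizing z with
  | zero => exact ⟨toChart x y 1 z, 0, by simp⟩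
  | succ n ih =>
    rw [Fin.prod_univ_castSucc] at hz
    refine Submodule.mul_induction_on hz (fun c hc d hd => ?_) (fun c d hc hd => ?_)
    · obtain ⟨a, b, hab⟩ := ih (fun i => m i.castSucc) (fun i => hm _) hc
      obtain ⟨e, f, rfl⟩ := Ideal.mem_span_pair.1 hd
      obtain ⟨k, hk⟩ := Nat.exists_eq_add_of_le (hm (Fin.last n))
      refine ⟨a * toChart x y 1 e, b * chartVar x y 1 * toChart x y 1 e +
        (chartVar x y 1 ^ n * a + toChart x y 1 y * b) * toChart x y 1 f * toChart x y 1 y ^ k, ?_⟩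
      simp only [map_mul, map_add, map_pow, hab, hk]
      rw [toChart_left]
      ring
    · obtain ⟨a, b, hab⟩ := hc
      obtain ⟨a', b', hab'⟩ := hd
      exact ⟨a + a', b + b', by rw [map_add, hab, hab']; ring⟩

/-- A column `y e - x f` of the module has the linear relation `e ≡ f` up to a shift. -/
theorem residue_castSucc_eq_residue_succ (h : IsRegularPair x y) (m : Fin (s + 1) → ℕ)
    (hm : ∀ i, 2 ≤ m i) {e f : Fin (s + 1) → R}
    (hef : monomialForm s x y (y • e - x • f) ∈ ∏ i, Ideal.span {x, y ^ m i}) (i : Fin s) :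
    residue R (e i.castSucc) = residue R (f i.succ) := by
  obtain ⟨a, b, hab⟩ := toChart_mem_of_mem_prod_span_pair m hm hef
  rw [map_sub, map_smul, map_smul, smul_eq_mul, smul_eq_mul, map_sub, map_mul, map_mul,
    toChart_monomialForm, toChart_monomialForm, toChart_left] at hab
  have h1 : chartForm s x y e - chartVar x y 1 * chartForm s x y f =
      chartVar x y 1 ^ (s + 1) * a + toChart x y 1 y * b :=
    toChart_pow_mul_cancel h le_rfl (s + 1) (by rw [← hab]; ring)
  have h2 := congrArg (fun p => (chartReduction h le_rfl p).coeff (s - (i : ℕ))) h1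
  simp only [map_sub, map_add, map_mul, map_pow, chartReduction_toChart, chartReduction_chartVar,
    h.residue_eq_zero.2, C_0, zero_mul, add_zero, coeff_sub] at h2
  have h3 : s - (i : ℕ) = (s - ((i : ℕ) + 1)) + 1 := by omega
  have h4 := coeff_chartReduction_chartForm h e i.castSucc
  have h5 := coeff_chartReduction_chartForm h f i.succ
  rw [Fin.val_castSucc] at h4
  rw [Fin.val_succ] at h5
  rw [h4, coeff_X_pow_mul', if_neg (by omega), h3, coeff_X_mul, h5] at h2
  exact sub_eq_zero.1 h2

end SymbolForm

section Construction

variable {R : Type*} [CommRing R] {x y : R} {s : ℕ}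

/-- The columns of coefficients of the elements of `(x, y ^ m 0) ⋯ (x, y ^ m s)` in terms of the
monomials of degree `s` in `x, y`. -/
def coeffModule (s : ℕ) (x y : R) (m : Fin (s + 1) → ℕ) : Submodule R (Fin (s + 1) → R) :=
  Submodule.comap (monomialForm s x y) (∏ i, Ideal.span {x, y ^ m i})

theorem mem_coeffModule {m : Fin (s + 1) → ℕ} {v : Fin (s + 1) → R} :
    v ∈ coeffModule s x y m ↔ monomialForm s x y v ∈ ∏ i, Ideal.span {x, y ^ m i} :=
  Iff.rfl

theorem smul_mem_coeffModule {m : Fin (s + 1) → ℕ} {a : R}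
    (ha : a ∈ ∏ i, Ideal.span {x, y ^ m i}) (v : Fin (s + 1) → R) :
    a • v ∈ coeffModule s x y m := by
  rw [mem_coeffModule, map_smul]
  exact Ideal.mul_mem_right _ _ ha

theorem stdRelCol_mem_coeffModule (m : Fin (s + 1) → ℕ) (k : Fin s) :
    stdRelCol (s + 1) x y k ∈ coeffModule s x y m := by
  rw [mem_coeffModule, monomialForm_stdRelCol]
  exact zero_mem _

theorem left_smul_single_mem_coeffModule (m : Fin (s + 1) → ℕ) :
    x • Pi.single 0 1 ∈ coeffModule s x y m := by
  rw [mem_coeffModule, map_smul, monomialForm_single]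
  have h := left_pow_mem_prod_span_pair (x := x) (y := y) m
  simpa [pow_succ'] using h

theorem span_pair_pow_le_span_pair_pow (x y : R) (k : ℕ) :
    Ideal.span {x, y} ^ k ≤ Ideal.span {x, y ^ k} := by
  induction k with
  | zero =>
    rw [(Ideal.eq_top_iff_one (Ideal.span {x, y ^ 0})).2 (Ideal.subset_span (by simp))]
    exact le_top
  | succ k ih =>
    rw [pow_succ]
    refine (Ideal.mul_mono_left ih).trans (Ideal.mul_le.2 fun a ha b hb => ?_)
    obtain ⟨a₁, a₂, rfl⟩ := Ideal.mem_span_pair.1 ha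
    obtain ⟨b₁, b₂, rfl⟩ := Ideal.mem_span_pair.1 hb
    exact Ideal.mem_span_pair.2
      ⟨a₁ * (b₁ * x + b₂ * y) + a₂ * y ^ k * b₁, a₂ * b₂, by ring⟩

variable [IsLocalRing R]

theorem isFiniteLength_quotient_of_pow_le [IsNoetherianRing R] {I : Ideal R} (hI : I ≠ ⊤) {n : ℕ}
    (hn : maximalIdeal R ^ n ≤ I) : IsFiniteLength R (R ⧸ I) := by
  have hart : IsArtinianRing (R ⧸ I) := by
    refine IsLocalRing.quotient_artinian_of_mem_minimalPrimes_of_isLocalRing I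
      ⟨⟨inferInstance, le_maximalIdeal hI⟩, fun J ⟨hJ, hIJ⟩ _ => hJ.le_of_pow_le (hn.trans hIJ)⟩
  rw [isFiniteLength_iff_isNoetherian_isArtinian]
  exact ⟨inferInstance, isArtinian_of_surjective_algebraMap (Ideal.Quotient.mk_surjective (I := I))⟩

theorem finColength_of_smul_mem [IsNoetherianRing R] {r : ℕ} {M : Submodule R (Fin r → R)}
    {I : Ideal R} (hI : I ≠ ⊤) {n : ℕ} (hn : maximalIdeal R ^ n ≤ I)
    (hM : ∀ a ∈ I, ∀ v, a • v ∈ M) : FinColength M := by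
  have hfl := isFiniteLength_iff_isNoetherian_isArtinian.1 (isFiniteLength_quotient_of_pow_le hI hn)
  have := hfl.1
  have := hfl.2
  have hle : Submodule.pi Set.univ (fun _ : Fin r => I) ≤ M := fun v hv => by
    rw [pi_eq_sum_univ' v]
    exact sum_mem fun i _ => hM _ (hv i trivial) _
  have hpi : IsFiniteLength R (Fin r → R ⧸ I) :=
    isFiniteLength_iff_isNoetherian_isArtinian.2 ⟨inferInstance, inferInstance⟩
  refine IsFiniteLength.of_surjective hpi (f := (Submodule.factor hle).comp
    (Submodule.quotientPi fun _ : Fin r => I).symm.toLinearMap) ?_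
  exact (Submodule.factor_surjective hle).comp (LinearEquiv.surjective _)

theorem finColength_coeffModule [IsNoetherianRing R] [IsDomain R] (h : IsRegularPair x y)
    (m : Fin (s + 1) → ℕ) (hm : ∀ i, 1 ≤ m i) : FinColength (coeffModule s x y m) := by
  have hle := prod_span_pair_le_pow (x := x) (y := y) m hm
  rw [← h.maximalIdeal_eq] at hle
  refine finColength_of_smul_mem (I := ∏ i, Ideal.span {x, y ^ m i}) (n := ∑ i, m i)
    (fun htop => ?_) ?_ fun a ha v => smul_mem_coeffModule ha v
  · rw [htop] at hle
    exact (maximalIdeal.isMaximal R).ne_top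
      (top_le_iff.1 (hle.trans (Ideal.pow_le_self s.succ_ne_zero)))
  · rw [← Finset.prod_pow_eq_pow_sum, h.maximalIdeal_eq]
    exact Finset.prod_le_prod' fun i _ => span_pair_pow_le_span_pair_pow x y (m i)

theorem maxMinors_coeffModule [IsDomain R] (h : IsRegularPair x y)
    (m : Fin (s + 1) → ℕ) (hmono : Monotone m) (hm : ∀ i, 1 ≤ m i) :
    maxMinors (coeffModule s x y m) = ∏ i, Ideal.span {x, y ^ m i} := by
  apply le_antisymm
  · rw [maxMinors, Ideal.span_le]
    rintro _ ⟨w, hw, rfl⟩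
    refine mem_prod_span_pair_of_mem_chartIdeal h m hmono hm fun q => ?_
    refine pow_mul_mem_chartIdeal h (hm q) (s := s) ?_
    have hcr := monomial_mul_colDet x y w (Fin.last s)
    simp only [Fin.val_last, Nat.sub_self, pow_zero, one_mul] at hcr
    rw [hcr]
    refine sum_mem fun j _ => chartIdeal_mul_le _ _ (Ideal.mul_mem_mul
      (prod_span_pair_le_chartIdeal m (m q) (hw j)) ?_)
    rw [Matrix.adjugate_fin_succ_eq_det_submatrix]
    refine Ideal.mul_mem_left _ _ (det_mem_chartIdeal _ fun a b => ?_)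
    have hle1 : maximalIdeal R ≤ chartIdeal x y (m q) 1 := by
      rw [h.maximalIdeal_eq]
      simpa [hm q] using span_pair_le_chartIdeal (x := x) (y := y) (q := m q) 1
    refine hle1 (mem_maximalIdeal_of_monomialForm_mem h ?_ _)
    have h1 := prod_span_pair_le_chartIdeal m 1 (hw (Fin.succAbove j b))
    simpa [hm] using h1
  · intro z hz
    have hz' := Ideal.pow_le_pow_right s.le_succ (prod_span_pair_le_pow m hm hz)
    obtain ⟨v, rfl⟩ := span_pair_pow_le_range_monomialForm x y hz'
    have hdet := colDet_cons_stdRelCol (x := x) h.prime_right.ne_zero v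
    have hmem : colDet (Fin.cons v fun k : Fin s => stdRelCol (s + 1) x y k) ∈
        maxMinors (coeffModule s x y m) := by
      refine Ideal.subset_span ⟨_, fun j => ?_, rfl⟩
      cases j using Fin.cases with
      | zero => exact hz
      | succ k => exact stdRelCol_mem_coeffModule m k
    rw [hdet] at hmem
    exact (Ideal.unit_mul_mem_iff_mem _ (isUnit_one.neg.pow s)).1 hmem

theorem modIntClosed_coeffModule [IsDomain R] (h : IsRegularPair x y)
    (m : Fin (s + 1) → ℕ) (hmono : Monotone m) (hm : ∀ i, 1 ≤ m i) :
    ModIntClosed (coeffModule s x y m) := by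
  intro v hv
  have hint := hv (Fin.cons v fun k : Fin s => stdRelCol (s + 1) x y k) 0 (Fin.cons_zero _ _)
    fun j hj => by
      obtain ⟨k, rfl⟩ := Fin.exists_succ_eq.2 hj
      exact stdRelCol_mem_coeffModule m k
  rw [maxMinors_coeffModule h m hmono hm, colDet_cons_stdRelCol h.prime_right.ne_zero] at hint
  exact (Ideal.unit_mul_mem_iff_mem _ (isUnit_one.neg.pow s)).1
    (idealIntClosed_prod_span_pair h m hmono hm _ hint)

end Construction

section Indecomposable

variable {R : Type*} [CommRing R] [IsLocalRing R] [IsDomain R] {x y : R} {s : ℕ}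

omit [IsDomain R] in
theorem isUnit_det_of_residue_upperTriangular {r : ℕ} (A : Matrix (Fin r) (Fin r) R)
    (hlow : ∀ i j, j < i → residue R (A i j) = 0) (hdiag : ∀ i, residue R (A i i) = 1) :
    IsUnit A.det := by
  rw [← residue_ne_zero_iff_isUnit, RingHom.map_det, Matrix.det_of_isUpperTriangular]
  · simp [hdiag]
  · intro i j hij
    exact hlow i j hij

theorem eq_zero_or_eq_one_of_mulVec_mem (h : IsRegularPair x y) (m : Fin (s + 1) → ℕ)
    (hm : ∀ i, 2 ≤ m i) {E : Matrix (Fin (s + 1)) (Fin (s + 1)) R} (hE : E * E = E)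
    (hEM : ∀ v ∈ coeffModule s x y m, E.mulVec v ∈ coeffModule s x y m) : E = 0 ∨ E = 1 := by
  have hfirst : ∀ i : Fin s, residue R (E i.succ 0) = 0 := fun i => by
    have h1 := hEM _ (neg_mem (left_smul_single_mem_coeffModule m))
    rw [Matrix.mulVec_neg, Matrix.mulVec_smul, Matrix.mulVec_single_one, ← zero_sub,
      ← smul_zero y] at h1
    simpa using (residue_castSucc_eq_residue_succ h m hm h1 i).symm
  have hshift : ∀ i k : Fin s,
      residue R (E i.castSucc k.castSucc) = residue R (E i.succ k.succ) := fun i k => by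
    have h1 := hEM _ (stdRelCol_mem_coeffModule m k)
    rw [stdRelCol_eq, Matrix.mulVec_sub, Matrix.mulVec_smul, Matrix.mulVec_smul,
      Matrix.mulVec_single_one, Matrix.mulVec_single_one] at h1
    exact residue_castSucc_eq_residue_succ h m hm h1 i
  have hlow : ∀ k i : Fin (s + 1), k < i → residue R (E i k) = 0 := by
    intro k
    induction k using Fin.induction with
    | zero =>
      intro i hi
      obtain ⟨j, rfl⟩ := Fin.exists_succ_eq.2 hi.ne'
      exact hfirst j
    | succ k ih =>
      intro i hi
      obtain ⟨j, rfl⟩ := Fin.exists_succ_eq.2 (Fin.ne_zero_of_lt hi)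
      rw [← hshift]
      exact ih _ (by simpa using hi)
  have hdiag : ∀ i : Fin (s + 1), residue R (E i i) = residue R (E 0 0) := by
    intro i
    induction i using Fin.induction with
    | zero => rfl
    | succ i ih => rw [← hshift, ih]
  have hidem : residue R (E 0 0) * residue R (E 0 0) = residue R (E 0 0) := by
    conv_rhs => rw [← hE, Matrix.mul_apply, Fin.sum_univ_succ]
    simp [hfirst]
  rcases IsIdempotentElem.iff_eq_zero_or_one.1 hidem with h0 | h1
  · left
    have hu : IsUnit (1 - E).det := isUnit_det_of_residue_upperTriangular _
      (fun i j hij => by simp [Matrix.one_apply_ne hij.ne', hlow j i hij])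
      (fun i => by simp [hdiag, h0])
    have := (Matrix.isUnit_iff_isUnit_det _).2 hu
    exact this.mul_right_eq_zero.1 (by rw [sub_mul, hE, one_mul, sub_self])
  · right
    have hu : IsUnit E.det := isUnit_det_of_residue_upperTriangular _
      (fun i j hij => hlow j i hij) (fun i => by rw [hdiag, h1])
    have := (Matrix.isUnit_iff_isUnit_det _).2 hu
    exact this.mul_left_cancel (by rw [hE, mul_one])

/-- The projections of a decomposition of a submodule containing `x ^ a F` and `y ^ b F` extend to
the free module `F`. -/
theorem exists_matrix_of_decomposition (h : IsRegularPair x y) {r : ℕ}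
    {M N P : Submodule R (Fin r → R)} (hsup : N ⊔ P = M) (hinf : N ⊓ P = ⊥) {a b : ℕ}
    (ha : ∀ v, x ^ a • v ∈ M) (hb : ∀ v, y ^ b • v ∈ M) :
    ∃ E : Matrix (Fin r) (Fin r) R, E * E = E ∧ (∀ v ∈ N, E.mulVec v = v) ∧
      ∀ v ∈ P, E.mulVec v = 0 := by
  have hxa : x ^ a ≠ 0 := pow_ne_zero a h.prime_left.ne_zero
  have hex : ∀ i : Fin r, ∃ e : Fin r → R, x ^ a • e ∈ N ∧
      ∃ p ∈ P, x ^ a • e + p = x ^ a • Pi.single i 1 := by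
    intro i
    obtain ⟨n, hn, p, hp, hnp⟩ := Submodule.mem_sup.1 (hsup ▸ ha (Pi.single i 1))
    obtain ⟨n', hn', p', hp', hnp'⟩ := Submodule.mem_sup.1 (hsup ▸ hb (Pi.single i 1))
    have hN : y ^ b • n - x ^ a • n' ∈ N := sub_mem (N.smul_mem _ hn) (N.smul_mem _ hn')
    have hP : y ^ b • n - x ^ a • n' ∈ P := by
      have : y ^ b • n - x ^ a • n' = x ^ a • p' - y ^ b • p := by
        rw [sub_eq_sub_iff_add_eq_add, ← smul_add, ← smul_add, add_comm p', hnp', hnp,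
          smul_comm]
      rw [this]
      exact sub_mem (P.smul_mem _ hp') (P.smul_mem _ hp)
    have h0 : y ^ b • n - x ^ a • n' = 0 := by
      rw [← Submodule.mem_bot R, ← hinf]
      exact ⟨hN, hP⟩
    have hdvd : ∀ j, x ^ a ∣ n j := fun j => by
      refine h.prime_left.pow_dvd_of_dvd_mul_left a
        (fun hd => h.not_left_dvd (h.prime_left.dvd_of_dvd_pow hd)) (a := y ^ b) ⟨n' j, ?_⟩
      simpa using congrFun (sub_eq_zero.1 h0) j
    choose e he using hdvd
    have hne : n = x ^ a • e := funext he
    exact ⟨e, hne ▸ hn, p, hp, hne ▸ hnp⟩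
  choose e heN p hp hep using hex
  let E : Matrix (Fin r) (Fin r) R := Matrix.of fun i j => e j i
  have hmul : ∀ v, E.mulVec v = ∑ j, v j • e j := fun v => by
    funext i
    simp [E, Matrix.mulVec, dotProduct, mul_comm]
  have hEN : ∀ v, x ^ a • E.mulVec v ∈ N := fun v => by
    rw [hmul, Finset.smul_sum]
    exact sum_mem fun j _ => by rw [smul_comm]; exact N.smul_mem _ (heN j)
  have hEP : ∀ v, x ^ a • (v - E.mulVec v) ∈ P := fun v => by
    have : x ^ a • (v - E.mulVec v) = ∑ j, v j • p j := by
      have hpj : ∀ j, p j = x ^ a • Pi.single j 1 - x ^ a • e j := fun j =>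
        eq_sub_of_add_eq' (hep j)
      simp only [hpj, smul_sub, Finset.sum_sub_distrib, smul_comm _ (x ^ a), ← Finset.smul_sum]
      rw [hmul, ← pi_eq_sum_univ' v]
    rw [this]
    exact sum_mem fun j _ => P.smul_mem _ (hp j)
  have hzero : ∀ v, x ^ a • v ∈ N → x ^ a • v ∈ P → v = 0 := fun v h1 h2 => by
    have : x ^ a • v ∈ N ⊓ P := ⟨h1, h2⟩
    rw [hinf, Submodule.mem_bot] at this
    exact (smul_eq_zero.1 this).resolve_left hxa
  have hfixN : ∀ v, x ^ a • v ∈ N → E.mulVec v = v := fun v hv =>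
    (sub_eq_zero.1 (hzero (v - E.mulVec v)
      (by rw [smul_sub]; exact sub_mem hv (hEN v)) (hEP v))).symm
  refine ⟨E, ?_, fun v hv => hfixN v (N.smul_mem _ hv), fun v hv => ?_⟩
  · refine Matrix.mulVec_injective (funext fun v => ?_)
    rw [← Matrix.mulVec_mulVec]
    exact hfixN _ (hEN v)
  · refine hzero _ (hEN v) ?_
    have := sub_mem (P.smul_mem (x ^ a) hv) (hEP v)
    rwa [← smul_sub, sub_sub_cancel] at this

theorem indecomposableSub_coeffModule (h : IsRegularPair x y) (m : Fin (s + 1) → ℕ)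
    (hm : ∀ i, 2 ≤ m i) : IndecomposableSub (coeffModule s x y m) := by
  refine ⟨fun hbot => ?_, ?_⟩
  · have h0 := left_smul_single_mem_coeffModule (x := x) (y := y) m
    rw [hbot, Submodule.mem_bot] at h0
    exact h.prime_left.ne_zero (by simpa using congrFun h0 0)
  · rintro ⟨N, P, hsup, hinf, hN, hP⟩
    obtain ⟨E, hE, hEN, hEP⟩ := exists_matrix_of_decomposition h hsup hinf
      (fun v => smul_mem_coeffModule (left_pow_mem_prod_span_pair m) v)
      (fun v => smul_mem_coeffModule (right_pow_mem_prod_span_pair m) v)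
    have hEM : ∀ v ∈ coeffModule s x y m, E.mulVec v ∈ coeffModule s x y m := by
      intro v hv
      rw [← hsup] at hv ⊢
      obtain ⟨n, hn, p, hp, rfl⟩ := Submodule.mem_sup.1 hv
      rw [Matrix.mulVec_add, hEN n hn, hEP p hp, add_zero]
      exact Submodule.mem_sup_left hn
    rcases eq_zero_or_eq_one_of_mulVec_mem h m hm hE hEM with rfl | rfl
    · exact hN ((Submodule.eq_bot_iff _).2 fun v hv => by rw [← hEN v hv, Matrix.zero_mulVec])
    · exact hP ((Submodule.eq_bot_iff _).2 fun v hv => by rw [← hEP v hv, Matrix.one_mulVec])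

end Indecomposable

theorem isRegularPair_of_isTwoDimRegularLocal {R : Type*} [CommRing R] [IsLocalRing R]
    (hreg : IsTwoDimRegularLocal R) {x y : R} (hm : maximalIdeal R = Ideal.span {x, y}) :
    IsDomain R ∧ IsRegularPair x y := by
  have := hreg.1
  obtain ⟨hdom, hy, hyx⟩ := isDomain_and_prime_of_maximalIdeal_eq_span_pair hreg.2.1 hm
  obtain ⟨-, hx, hxy⟩ := isDomain_and_prime_of_maximalIdeal_eq_span_pair hreg.2.1
    (x := y) (y := x) (hm.trans (by rw [Set.pair_comm]))
  exact ⟨hdom, hm, hx, hy, hxy, hyx⟩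

/-- for `𝔪 = (x, y)` and `I = (x, y^{m₁})(x, y^{m₂}) ⋯ (x, y^{m_r})` with
`2 ≤ m₁ ≤ m₂ ≤ ⋯ ≤ m_r` and `r ≥ 2`, `I = I(M)` for an indecomposable integrally closed
module `M` of rank `r`. -/
theorem statement12 (R : Type*) [CommRing R] [IsLocalRing R]
    (hreg : IsTwoDimRegularLocal R) [Infinite (IsLocalRing.ResidueField R)]
    (x y : R) (hm : maximalIdeal R = Ideal.span {x, y})
    (r : ℕ) (hr : 2 ≤ r) (m : Fin r → ℕ) (hm2 : ∀ i, 2 ≤ m i) (hmono : Monotone m) :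
    ∃ M : Submodule R (Fin r → R),
      FinColength M ∧ ModIntClosed M ∧ IndecomposableSub M ∧
      maxMinors M = ∏ i : Fin r, Ideal.span {x, y ^ m i} := by
  obtain ⟨hdom, h⟩ := isRegularPair_of_isTwoDimRegularLocal hreg hm
  have := hreg.1
  obtain ⟨s, rfl⟩ := Nat.exists_eq_succ_of_ne_zero (show r ≠ 0 by omega)
  have hm1 : ∀ i, 1 ≤ m i := fun i => one_le_two.trans (hm2 i)
  exact ⟨coeffModule s x y m, finColength_coeffModule h m hm1,
    modIntClosed_coeffModule h m hmono hm1, indecomposableSub_coeffModule h m hm2,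
    maxMinors_coeffModule h m hmono hm1⟩
end

section
/- Let (R, 𝔪) be a two-dimensional regular local ring with infinite residue field, let J and K be 𝔪-primary integrally closed ideals of orders s and t respectively, and let I = JK, of order r = s + t. Then the following are equivalent: (1) both (a) λ(R/JK) = λ(R/J) + λ(R/K) + st and (b) 𝔪^{r-1} = 𝔪^{t-1} J + 𝔪^{s-1} K hold; (2) for any joint reduction a, b of J, K, both (a) JK = aK + bJ and (b) 𝔪^{r-1} = a𝔪^{t-1} + b𝔪^{s-1} hold. -/
open IsLocalRing

/-- The nontrivial half of Nakayama for a prime `P` and an element `z ∉ P`: if every element of `P`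
is a multiple of `z` modulo an ideal `Q ≤ P`, then `P = Q`. -/
theorem prime_eq_of_forall_eq_mul_add {R : Type*} [CommRing R] [IsLocalRing R] [IsNoetherianRing R]
    {P Q : Ideal R} (hP : P.IsPrime) (hQP : Q ≤ P) {z : R} (hz : z ∈ maximalIdeal R) (hzP : z ∉ P)
    (h : ∀ p ∈ P, ∃ c, ∃ q ∈ Q, p = z * c + q) : P = Q := by
  refine le_antisymm ?_ hQP
  refine Submodule.le_of_le_smul_of_le_jacobson_bot (I := maximalIdeal R)
    (IsNoetherian.noetherian P) (maximalIdeal_le_jacobson ⊥) ?_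
  intro p hp
  obtain ⟨c, q, hq, rfl⟩ := h p hp
  have hzc : z * c ∈ P := by
    have := P.sub_mem hp (hQP hq)
    simpa using this
  rw [add_comm]
  exact Submodule.add_mem_sup hq
    (Submodule.smul_mem_smul hz ((hP.mem_or_mem hzc).resolve_left hzP))

/-- In a two-dimensional regular local ring, `𝔪 = (x, y)` with `y` in no minimal prime. -/
theorem exists_param_notMem_minimalPrimes {R : Type*} [CommRing R] [IsLocalRing R]
    (hreg : IsTwoDimRegularLocal R) :
    ∃ x y : R, maximalIdeal R = Ideal.span {x, y} ∧ ∀ P ∈ minimalPrimes R, y ∉ P := by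
  obtain ⟨hN, hdim, x, y, hxy⟩ := hreg
  have hht : (maximalIdeal R).height = 2 := by
    have := maximalIdeal_height_eq_ringKrullDim (R := R)
    rw [hdim] at this
    exact WithBot.coe_injective this
  have hfin := minimalPrimes.finite_of_isNoetherianRing R
  have hmin : ∀ P ∈ minimalPrimes R, ¬ maximalIdeal R ≤ P := by
    intro P hP hle
    have : maximalIdeal R = P :=
      (IsLocalRing.eq_maximalIdeal ((IsLocalRing.maximalIdeal.isMaximal R).eq_of_le
        hP.1.1.ne_top hle ▸ IsLocalRing.maximalIdeal.isMaximal R)).symm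
    rw [← this] at hP
    have h0 := Ideal.height_eq_zero_iff.2 hP
    rw [hht] at h0
    exact two_ne_zero h0
  have hsq : ¬ maximalIdeal R ≤ maximalIdeal R ^ 2 := by
    intro hle
    have hbot : maximalIdeal R = ⊥ :=
      Submodule.eq_bot_of_le_smul_of_le_jacobson_bot (maximalIdeal R) _
        (IsNoetherian.noetherian _) (by rwa [smul_eq_mul, ← sq]) (maximalIdeal_le_jacobson ⊥)
    obtain ⟨P, hP, -⟩ := Ideal.exists_minimalPrimes_le (bot_le : (⊥ : Ideal R) ≤ maximalIdeal R)
    exact hmin P hP (hbot ▸ bot_le)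
  obtain ⟨z, hzm, hz2, hzP⟩ : ∃ z ∈ maximalIdeal R, z ∉ maximalIdeal R ^ 2 ∧
      ∀ P ∈ minimalPrimes R, z ∉ P := by
    by_contra! hcon
    have hsub : ((maximalIdeal R : Ideal R) : Set R) ⊆
        ⋃ i ∈ ((insert (maximalIdeal R ^ 2) hfin.toFinset : Finset (Ideal R)) : Set (Ideal R)),
          ((id i : Ideal R) : Set R) := by
      intro z hz
      simp only [Finset.coe_insert, Set.Finite.coe_toFinset, Set.mem_iUnion]
      by_cases h2 : z ∈ maximalIdeal R ^ 2
      · exact ⟨_, Or.inl rfl, h2⟩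
      · obtain ⟨P, hP, hzP⟩ := hcon z hz h2
        exact ⟨P, Or.inr hP, hzP⟩
    rw [Ideal.subset_union_prime (maximalIdeal R ^ 2) (maximalIdeal R ^ 2)] at hsub
    · obtain ⟨i, hi, hle⟩ := hsub
      rcases Finset.mem_insert.1 hi with rfl | hi
      · exact hsq hle
      · exact hmin i (hfin.mem_toFinset.1 hi) hle
    · intro i hi hne _
      exact ((hfin.mem_toFinset.1 ((Finset.mem_insert.1 hi).resolve_left hne)).1).1
  obtain ⟨α, β, rfl⟩ : ∃ α β, α * x + β * y = z := Ideal.mem_span_pair.1 (hxy ▸ hzm)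
  have hxm : x ∈ maximalIdeal R := hxy ▸ Ideal.subset_span (by simp)
  have hym : y ∈ maximalIdeal R := hxy ▸ Ideal.subset_span (by simp)
  have key : ∀ {x y α β : R}, maximalIdeal R = Ideal.span {x, y} → IsUnit α →
      α * x + β * y ∈ maximalIdeal R → maximalIdeal R = Ideal.span {y, α * x + β * y} := by
    intro x y α β hxy hα hz
    refine le_antisymm ?_ ?_
    · rw [hxy, Ideal.span_le]
      rintro w (rfl | rfl)
      · obtain ⟨γ, hγ⟩ := hα.exists_left_inv
        exact Ideal.mem_span_pair.2 ⟨-γ * β, γ, by linear_combination w * hγ⟩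
      · exact Ideal.subset_span (by simp)
    · rw [Ideal.span_le]
      rintro w (rfl | rfl)
      · exact hxy ▸ Ideal.subset_span (by simp)
      · exact hz
  by_cases hα : IsUnit α
  · exact ⟨y, _, key hxy hα hzm, hzP⟩
  by_cases hβ : IsUnit β
  · refine ⟨x, _, ?_, hzP⟩
    rw [add_comm]
    exact key (by rw [hxy, Set.pair_comm]) hβ (by rwa [add_comm])
  · refine absurd ?_ hz2
    rw [sq]
    exact Ideal.add_mem _ (Ideal.mul_mem_mul ((mem_maximalIdeal _).2 hα) hxm)
      (Ideal.mul_mem_mul ((mem_maximalIdeal _).2 hβ) hym)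

/-- A two-dimensional regular local ring is a domain whose maximal ideal is `(x, y)` with `y` prime
and not dividing `x`. -/
theorem isDomain_and_exists_params {R : Type*} [CommRing R] [IsLocalRing R]
    (hreg : IsTwoDimRegularLocal R) :
    IsDomain R ∧ ∃ x y : R, maximalIdeal R = Ideal.span {x, y} ∧ Prime y ∧ ¬ y ∣ x := by
  obtain ⟨x, y, hxy, hy⟩ := exists_param_notMem_minimalPrimes hreg
  obtain ⟨hN, hdim, -⟩ := hreg
  have hht : (maximalIdeal R).height = 2 := by
    have := maximalIdeal_height_eq_ringKrullDim (R := R)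
    rw [hdim] at this
    exact WithBot.coe_injective this
  have hxm : x ∈ maximalIdeal R := hxy ▸ Ideal.subset_span (by simp)
  have hym : y ∈ maximalIdeal R := hxy ▸ Ideal.subset_span (by simp)
  obtain ⟨P, hP, hPm⟩ := Ideal.exists_minimalPrimes_le
    ((Ideal.span_singleton_le_iff_mem _).2 hym : Ideal.span {y} ≤ maximalIdeal R)
  have hPp : P.IsPrime := hP.1.1
  have hyP : y ∈ P := hP.1.2 (Ideal.mem_span_singleton_self y)
  have hxP : x ∉ P := by
    intro hx
    have hle : maximalIdeal R ≤ P := by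
      rw [hxy, Ideal.span_le]
      rintro w (rfl | rfl) <;> assumption
    have h1 := Ideal.height_le_one_of_isPrincipal_of_mem_minimalPrimes _ P hP
    rw [le_antisymm hPm hle, hht] at h1
    exact absurd h1 (by decide)
  have hPeq : P = Ideal.span {y} := by
    refine prime_eq_of_forall_eq_mul_add hPp hP.1.2 hxm hxP fun p hp => ?_
    obtain ⟨α, β, rfl⟩ := Ideal.mem_span_pair.1 (hxy ▸ hPm hp)
    exact ⟨α, β * y, Ideal.mul_mem_left _ _ (Ideal.mem_span_singleton_self y), by ring⟩
  obtain ⟨P₀, hP₀, hP₀P⟩ := Ideal.exists_minimalPrimes_le (bot_le : (⊥ : Ideal R) ≤ P)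
  have hP₀p : P₀.IsPrime := hP₀.1.1
  have hbot : P₀ = ⊥ := by
    refine prime_eq_of_forall_eq_mul_add hP₀p bot_le hym (hy P₀ hP₀) fun p hp => ?_
    have hpP := hP₀P hp
    rw [hPeq, Ideal.mem_span_singleton] at hpP
    obtain ⟨c, rfl⟩ := hpP
    exact ⟨c, 0, rfl, by simp⟩
  have hdom : IsDomain R := by
    rw [hbot] at hP₀p
    exact IsDomain.of_bot_isPrime R
  have hy0 : y ≠ 0 := by
    rintro rfl
    exact hy P₀ hP₀ P₀.zero_mem
  refine ⟨hdom, x, y, hxy, ?_, ?_⟩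
  · rw [← Ideal.span_singleton_prime hy0, ← hPeq]
    exact hPp
  · rwa [← Ideal.mem_span_singleton, ← hPeq]

/-- Every relation between `a` and `b` is a multiple of the Koszul relation. -/
def OnlyKoszulRelations {R : Type*} [CommRing R] (a b : R) : Prop :=
  ∀ u v : R, a * u = b * v → ∃ w, u = b * w ∧ v = a * w

section Colength

variable {R : Type*} [CommRing R]

/-- The colength of an ideal. -/
noncomputable def colength (I : Ideal R) : ℕ∞ := Module.length R (R ⧸ I)

theorem modLength_quotient_eq (I : Ideal R) : modLength R (R ⧸ I) = (colength I : WithBot ℕ∞) :=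
  (Module.coe_length R (R ⧸ I)).symm

theorem colength_anti {I J : Ideal R} (h : I ≤ J) : colength J ≤ colength I :=
  Module.length_le_of_surjective (Submodule.factor h) (Submodule.factor_surjective h)

theorem colength_top : colength (⊤ : Ideal R) = 0 := by
  unfold colength
  exact Module.length_eq_zero

theorem eq_of_le_of_colength_le {I J : Ideal R} (h : I ≤ J) (hJ : colength J ≠ ⊤)
    (hle : colength I ≤ colength J) : I = J := by
  have hex : Function.Exact (LinearMap.ker (Submodule.factor h)).subtype (Submodule.factor h) := by
    intro z
    simp
  have hadd := Module.length_eq_add_of_exact (LinearMap.ker (Submodule.factor h)).subtype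
    (Submodule.factor h) (Submodule.subtype_injective _) (Submodule.factor_surjective h) hex
  have h0 : Module.length R (LinearMap.ker (Submodule.factor h)) = 0 := by
    have h1 : Module.length R (LinearMap.ker (Submodule.factor h)) + colength J ≤ 0 + colength J := by
      rw [zero_add]
      exact hadd.symm.le.trans hle
    exact le_antisymm ((ENat.add_le_add_iff_right hJ).1 h1) bot_le
  refine le_antisymm h fun z hz => ?_
  have hsub := Module.length_eq_zero_iff.1 h0
  have hz' : (Submodule.Quotient.mk z : R ⧸ I) ∈ LinearMap.ker (Submodule.factor h) := by
    rw [LinearMap.mem_ker]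
    exact (Submodule.Quotient.mk_eq_zero J).2 hz
  have := congrArg Subtype.val (hsub.elim ⟨_, hz'⟩ 0)
  exact (Submodule.Quotient.mk_eq_zero I).1 this

theorem mem_span_singleton_mul_add {a b : R} {U V : Ideal R} {z : R} :
    z ∈ Ideal.span {a} * U + Ideal.span {b} * V ↔ ∃ u ∈ U, ∃ v ∈ V, a * u + b * v = z := by
  rw [Submodule.add_eq_sup, Submodule.mem_sup]
  simp only [Ideal.mem_span_singleton_mul]
  constructor
  · rintro ⟨_, ⟨u, hu, rfl⟩, _, ⟨v, hv, rfl⟩, rfl⟩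
    exact ⟨u, hu, v, hv, rfl⟩
  · rintro ⟨u, hu, v, hv, rfl⟩
    exact ⟨_, ⟨u, hu, rfl⟩, _, ⟨v, hv, rfl⟩, rfl⟩

/-- The map `(u, v) ↦ a u + b v` modulo the ideals `U`, `V` and `aU + bV`. -/
noncomputable def pairMap (a b : R) (U V : Ideal R) :
    ((R ⧸ U) × (R ⧸ V)) →ₗ[R] R ⧸ (Ideal.span {a} * U + Ideal.span {b} * V) :=
  LinearMap.coprod
    (Submodule.mapQ U (Ideal.span {a} * U + Ideal.span {b} * V) (LinearMap.mulLeft R a)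
      fun u hu => mem_span_singleton_mul_add.2 ⟨u, hu, 0, V.zero_mem, by simp⟩)
    (Submodule.mapQ V (Ideal.span {a} * U + Ideal.span {b} * V) (LinearMap.mulLeft R b)
      fun v hv => mem_span_singleton_mul_add.2 ⟨0, U.zero_mem, v, hv, by simp⟩)

theorem pairMap_mk (a b : R) (U V : Ideal R) (u v : R) :
    pairMap a b U V (Submodule.Quotient.mk u, Submodule.Quotient.mk v) =
      Submodule.Quotient.mk (a * u + b * v) := rfl

theorem span_mul_add_le_span_pair (a b : R) (U V : Ideal R) :
    Ideal.span {a} * U + Ideal.span {b} * V ≤ Ideal.span {a, b} := by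
  intro z hz
  obtain ⟨u, -, v, -, rfl⟩ := mem_span_singleton_mul_add.1 hz
  exact Ideal.mem_span_pair.2 ⟨u, v, by ring⟩

theorem colength_span_mul_add (a b : R) (U V : Ideal R) :
    colength (Ideal.span {a} * U + Ideal.span {b} * V) =
      Module.length R (LinearMap.range (pairMap a b U V)) + colength (Ideal.span {a, b}) := by
  refine Module.length_eq_add_of_exact (LinearMap.range (pairMap a b U V)).subtype
    (Submodule.factor (span_mul_add_le_span_pair a b U V)) (Submodule.subtype_injective _)
    (Submodule.factor_surjective _) ?_
  intro z
  obtain ⟨z, rfl⟩ := Submodule.Quotient.mk_surjective _ z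
  have h1 : Submodule.factor (span_mul_add_le_span_pair a b U V) (Submodule.Quotient.mk z) =
    Submodule.Quotient.mk z := rfl
  rw [h1, Submodule.Quotient.mk_eq_zero, Submodule.coe_subtype, Subtype.range_coe]
  constructor
  · intro hz
    obtain ⟨u, v, rfl⟩ := Ideal.mem_span_pair.1 hz
    exact ⟨(Submodule.Quotient.mk u, Submodule.Quotient.mk v), by
      rw [pairMap_mk, mul_comm a, mul_comm b]⟩
  · rintro ⟨⟨u, v⟩, huv⟩
    obtain ⟨u, rfl⟩ := Submodule.Quotient.mk_surjective _ u
    obtain ⟨v, rfl⟩ := Submodule.Quotient.mk_surjective _ v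
    rw [pairMap_mk, Submodule.Quotient.eq] at huv
    have h2 : a * u + b * v ∈ Ideal.span {a, b} :=
      Ideal.mem_span_pair.2 ⟨u, v, by ring⟩
    have := Ideal.sub_mem _ h2 (span_mul_add_le_span_pair a b U V huv)
    simpa using this

theorem colength_add_colength_eq (a b : R) (U V : Ideal R) :
    colength U + colength V = Module.length R (LinearMap.ker (pairMap a b U V)) +
      Module.length R (LinearMap.range (pairMap a b U V)) := by
  rw [colength, colength, ← Module.length_prod]
  refine Module.length_eq_add_of_exact (LinearMap.ker (pairMap a b U V)).subtype
    (pairMap a b U V).rangeRestrict (Submodule.subtype_injective _)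
    (LinearMap.surjective_rangeRestrict _) ?_
  intro z
  simp [Subtype.ext_iff]

/-- Elements of the kernel of `pairMap` come from multiples of the Koszul relation. -/
theorem OnlyKoszulRelations.exists_of_mem_ker {a b : R} (hab : OnlyKoszulRelations a b)
    {U V : Ideal R} {z : (R ⧸ U) × (R ⧸ V)} (hz : z ∈ LinearMap.ker (pairMap a b U V)) :
    ∃ w : R, z = (Submodule.Quotient.mk (b * w), Submodule.Quotient.mk (-a * w)) := by
  obtain ⟨u, v⟩ := z
  obtain ⟨u, rfl⟩ := Submodule.Quotient.mk_surjective _ u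
  obtain ⟨v, rfl⟩ := Submodule.Quotient.mk_surjective _ v
  rw [LinearMap.mem_ker, pairMap_mk, Submodule.Quotient.mk_eq_zero,
    mem_span_singleton_mul_add] at hz
  obtain ⟨u₀, hu₀, v₀, hv₀, h⟩ := hz
  obtain ⟨w, hw1, hw2⟩ := hab (u - u₀) (v₀ - v) (by linear_combination -h)
  refine ⟨w, ?_⟩
  rw [Prod.mk.injEq, Submodule.Quotient.eq, Submodule.Quotient.eq]
  constructor
  · rw [← hw1]; simpa using hu₀
  · rw [neg_mul, ← hw2]; simpa using hv₀

theorem OnlyKoszulRelations.colength_add_le {a b : R} (hab : OnlyKoszulRelations a b)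
    {U V W : Ideal R} (hU : ∀ w ∈ W, b * w ∈ U) (hV : ∀ w ∈ W, a * w ∈ V) :
    colength (Ideal.span {a, b}) + colength U + colength V ≤
      colength (Ideal.span {a} * U + Ideal.span {b} * V) + colength W := by
  have hker : Module.length R (LinearMap.ker (pairMap a b U V)) ≤ colength W := by
    let h : (R ⧸ W) →ₗ[R] (R ⧸ U) × (R ⧸ V) :=
      LinearMap.prod (Submodule.mapQ W U (LinearMap.mulLeft R b) fun w hw => hU w hw)
        (Submodule.mapQ W V (LinearMap.mulLeft R (-a)) fun w hw => by
          simpa using hV w hw)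
    have hle : LinearMap.ker (pairMap a b U V) ≤ LinearMap.range h := by
      intro z hz
      obtain ⟨w, rfl⟩ := hab.exists_of_mem_ker hz
      exact ⟨Submodule.Quotient.mk w, rfl⟩
    exact (Module.length_le_of_injective (Submodule.inclusion hle)
      (Submodule.inclusion_injective hle)).trans
      (Module.length_le_of_surjective h.rangeRestrict (LinearMap.surjective_rangeRestrict _))
  rw [add_assoc, colength_add_colength_eq a b, colength_span_mul_add]
  calc _ = Module.length R (LinearMap.range (pairMap a b U V)) + colength (Ideal.span {a, b}) +
        Module.length R (LinearMap.ker (pairMap a b U V)) := by abel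
    _ ≤ _ := by gcongr

theorem OnlyKoszulRelations.colength_eq {a b : R} (hab : OnlyKoszulRelations a b)
    {U V : Ideal R} (hU : b ∈ U) (hV : a ∈ V) :
    colength (Ideal.span {a} * U + Ideal.span {b} * V) =
      colength (Ideal.span {a, b}) + colength U + colength V := by
  refine le_antisymm ?_ ?_
  · rw [add_assoc, colength_add_colength_eq a b, colength_span_mul_add, add_comm]
    gcongr
    exact le_add_self
  · refine (hab.colength_add_le (W := ⊤) (fun w _ => U.mul_mem_right _ hU)
      fun w _ => V.mul_mem_right _ hV).trans ?_
    rw [colength_top, add_zero]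

theorem OnlyKoszulRelations.colength_span_mul_pair {a b c : R} (h : OnlyKoszulRelations a c) :
    colength (Ideal.span {a * b, c}) =
      colength (Ideal.span {a, c}) + colength (Ideal.span {b, c}) := by
  have := h.colength_eq (U := Ideal.span {b, c}) (V := ⊤) (Ideal.subset_span (by simp)) trivial
  rw [colength_top, add_zero] at this
  rw [← this]
  congr 1
  apply le_antisymm
  · rw [Ideal.span_le]
    rintro w (rfl | rfl)
    · exact mem_span_singleton_mul_add.2 ⟨b, Ideal.subset_span (by simp), 0, trivial, by simp⟩
    · exact mem_span_singleton_mul_add.2 ⟨0, Ideal.zero_mem _, 1, trivial, by simp⟩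
  · intro z hz
    obtain ⟨u, hu, v, -, rfl⟩ := mem_span_singleton_mul_add.1 hz
    obtain ⟨p, q, rfl⟩ := Ideal.mem_span_pair.1 hu
    exact Ideal.mem_span_pair.2 ⟨p, a * q + v, by ring⟩

end Colength

section RegularParameters

variable {R : Type*} [CommRing R] [IsDomain R] {x y : R}

theorem onlyKoszulRelations_of_prime (hy : Prime y) (hyx : ¬ y ∣ x) :
    OnlyKoszulRelations x y := by
  intro u v h
  obtain ⟨w, rfl⟩ := (hy.dvd_or_dvd (⟨v, h⟩ : y ∣ x * u)).resolve_left hyx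
  refine ⟨w, rfl, mul_left_cancel₀ hy.ne_zero ?_⟩
  linear_combination -h

/-- The socle of `R / (a)` vanishes for `a ≠ 0`. -/
theorem dvd_of_dvd_mul_of_dvd_mul (hy : Prime y) (hyx : ¬ y ∣ x) {a c : R} (ha : a ≠ 0)
    (h1 : a ∣ x * c) (h2 : a ∣ y * c) : a ∣ c := by
  obtain ⟨p, hp⟩ := h1
  obtain ⟨q, hq⟩ := h2
  obtain ⟨w, -, hw⟩ := onlyKoszulRelations_of_prime hy hyx q p
    (mul_left_cancel₀ ha (by linear_combination y * hp - x * hq))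
  have hx : x ≠ 0 := by
    rintro rfl
    exact hyx (dvd_zero y)
  exact ⟨w, mul_left_cancel₀ hx (by rw [hp, hw]; ring)⟩

variable [IsLocalRing R]

theorem dvd_of_forall_mem_pow_dvd_mul (hxy : maximalIdeal R = Ideal.span {x, y}) (hy : Prime y)
    (hyx : ¬ y ∣ x) {a c : R} (ha : a ≠ 0) {N : ℕ}
    (h : ∀ z ∈ maximalIdeal R ^ N, a ∣ z * c) : a ∣ c := by
  have hxm : x ∈ maximalIdeal R := hxy ▸ Ideal.subset_span (by simp)
  have hym : y ∈ maximalIdeal R := hxy ▸ Ideal.subset_span (by simp)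
  induction N with
  | zero => simpa using h 1 (by simp)
  | succ N ih =>
    refine ih fun z hz => dvd_of_dvd_mul_of_dvd_mul hy hyx ha ?_ ?_
    · rw [← mul_assoc, mul_comm x]
      exact h _ (by rw [pow_succ]; exact Ideal.mul_mem_mul hz hxm)
    · rw [← mul_assoc, mul_comm y]
      exact h _ (by rw [pow_succ]; exact Ideal.mul_mem_mul hz hym)

variable [IsNoetherianRing R]

/-- A system of parameters of a two-dimensional regular local ring is a regular sequence. -/
theorem onlyKoszulRelations_of_le_radical (hxy : maximalIdeal R = Ideal.span {x, y}) (hy : Prime y)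
    (hyx : ¬ y ∣ x) {a b : R} (h : maximalIdeal R ≤ (Ideal.span {a, b}).radical) :
    OnlyKoszulRelations a b := by
  obtain ⟨N, hN⟩ := Ideal.exists_pow_le_of_le_radical_of_fg h (IsNoetherian.noetherian _)
  have hxm : x ∈ maximalIdeal R := hxy ▸ Ideal.subset_span (by simp)
  have hx : x ≠ 0 := by
    rintro rfl
    exact hyx (dvd_zero y)
  intro u v huv
  by_cases ha : a = 0
  · subst ha
    have hb : b ≠ 0 := by
      rintro rfl
      have := hN (Ideal.pow_mem_pow hxm N)
      simp only [Set.pair_eq_singleton, Ideal.span_singleton_zero, Ideal.mem_bot] at this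
      exact hx (pow_eq_zero_iff (by rintro rfl; simp at this) |>.1 this)
    have hv : v = 0 := by simpa [hb] using huv.symm
    obtain ⟨b', hb'⟩ : b ∣ 1 := by
      refine dvd_of_forall_mem_pow_dvd_mul hxy hy hyx hb (N := N) fun z hz => ?_
      obtain ⟨α, β, rfl⟩ := Ideal.mem_span_pair.1 (hN hz)
      exact ⟨β, by ring⟩
    exact ⟨b' * u, by rw [← mul_assoc, ← hb', one_mul], by simp [hv]⟩
  · obtain ⟨w, rfl⟩ : a ∣ v := by
      refine dvd_of_forall_mem_pow_dvd_mul hxy hy hyx ha (N := N) fun z hz => ?_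
      obtain ⟨α, β, rfl⟩ := Ideal.mem_span_pair.1 (hN hz)
      exact ⟨α * v + β * u, by linear_combination -β * huv⟩
    exact ⟨w, mul_left_cancel₀ ha (by rw [huv]; ring), rfl⟩

theorem le_radical_span_pow_pow {R : Type*} [CommRing R] {I : Ideal R} {a b : R}
    (h : I ≤ (Ideal.span {a, b}).radical)
    (M L : ℕ) : I ≤ (Ideal.span {a ^ M, b ^ L}).radical := by
  refine h.trans (Ideal.radical_le_radical_iff.2 (Ideal.span_le.2 ?_))
  rintro z (rfl | rfl)
  · exact ⟨M, Ideal.subset_span (by simp)⟩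
  · exact ⟨L, Ideal.subset_span (by simp)⟩

theorem colength_span_pow_left (hxy : maximalIdeal R = Ideal.span {x, y}) (hy : Prime y)
    (hyx : ¬ y ∣ x) {a b : R} (h : maximalIdeal R ≤ (Ideal.span {a, b}).radical) (M : ℕ) :
    colength (Ideal.span {a ^ M, b}) = M * colength (Ideal.span {a, b}) := by
  induction M with
  | zero =>
    have : Ideal.span {a ^ 0, b} = ⊤ := (Ideal.eq_top_iff_one _).2 (Ideal.subset_span (by simp))
    rw [this, colength_top]
    simp
  | succ M ih =>
    have := le_radical_span_pow_pow h M 1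
    rw [pow_one] at this
    rw [pow_succ, (onlyKoszulRelations_of_le_radical hxy hy hyx this).colength_span_mul_pair, ih]
    push_cast
    ring

/-- Multiplicativity of `λ(R/(a, b))`. -/
theorem colength_span_pow_pow (hxy : maximalIdeal R = Ideal.span {x, y}) (hy : Prime y)
    (hyx : ¬ y ∣ x) {a b : R} (h : maximalIdeal R ≤ (Ideal.span {a, b}).radical) (M L : ℕ) :
    colength (Ideal.span {a ^ M, b ^ L}) = M * L * colength (Ideal.span {a, b}) := by
  have h1 := le_radical_span_pow_pow h 1 L
  rw [pow_one] at h1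
  rw [Set.pair_comm] at h
  rw [colength_span_pow_left hxy hy hyx h1, Set.pair_comm a, colength_span_pow_left hxy hy hyx h,
    Set.pair_comm b, mul_assoc]

theorem colength_maximalIdeal {R : Type*} [CommRing R] [IsLocalRing R] :
    colength (maximalIdeal R) = 1 := by
  rw [colength, Module.length_eq_one_iff]
  exact isSimpleModule_iff_isCoatom.2 (Ideal.isMaximal_def.1 inferInstance)

theorem maximalIdeal_pow_succ {R : Type*} [CommRing R] [IsLocalRing R] {x y : R}
    (hxy : maximalIdeal R = Ideal.span {x, y}) (k : ℕ) :
    maximalIdeal R ^ (k + 1) =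
      Ideal.span {x} * maximalIdeal R ^ k + Ideal.span {y ^ (k + 1)} * ⊤ := by
  have hm : maximalIdeal R = Ideal.span {x} + Ideal.span {y} := by
    rw [hxy, Ideal.span_insert, Ideal.add_eq_sup]
  have hxm : Ideal.span {x} ≤ maximalIdeal R := by rw [hm]; exact le_sup_left
  have hym : Ideal.span {y} ≤ maximalIdeal R := by rw [hm]; exact le_sup_right
  rw [Ideal.mul_top, ← Ideal.span_singleton_pow]
  refine le_antisymm ?_ (sup_le ?_ (Ideal.pow_right_mono hym _))
  · induction k with
    | zero => simp [hm]
    | succ k ih =>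
      calc maximalIdeal R ^ (k + 1 + 1)
          = Ideal.span {x} * maximalIdeal R ^ (k + 1) +
            Ideal.span {y} * maximalIdeal R ^ (k + 1) := by
            rw [pow_succ' _ (k + 1), ← add_mul, ← hm]
        _ ≤ Ideal.span {x} * maximalIdeal R ^ (k + 1) + Ideal.span {y} *
            (Ideal.span {x} * maximalIdeal R ^ k + Ideal.span {y} ^ (k + 1)) :=
            sup_le_sup_left (Ideal.mul_mono_right ih) _
        _ ≤ _ := by
            rw [mul_add, ← pow_succ']
            refine sup_le le_sup_left (sup_le (le_sup_of_le_left ?_) le_sup_right)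
            rw [mul_left_comm]
            refine Ideal.mul_mono_right ?_
            rw [pow_succ']
            exact Ideal.mul_mono_left hym
  · rw [pow_succ']
    exact Ideal.mul_mono_left hxm

theorem colength_span_params (hxy : maximalIdeal R = Ideal.span {x, y}) (hy : Prime y)
    (hyx : ¬ y ∣ x) (M L : ℕ) : colength (Ideal.span {x ^ M, y ^ L}) = M * L := by
  rw [colength_span_pow_pow hxy hy hyx (hxy ▸ Ideal.le_radical), ← hxy, colength_maximalIdeal,
    mul_one]

theorem colength_maximalIdeal_pow_succ (hxy : maximalIdeal R = Ideal.span {x, y}) (hy : Prime y)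
    (hyx : ¬ y ∣ x) (k : ℕ) :
    colength (maximalIdeal R ^ (k + 1)) = k + 1 + colength (maximalIdeal R ^ k) := by
  have hym : y ∈ maximalIdeal R := hxy ▸ Ideal.subset_span (by simp)
  have hk : OnlyKoszulRelations x (y ^ (k + 1)) := by
    refine onlyKoszulRelations_of_le_radical hxy hy hyx ?_
    simpa using le_radical_span_pow_pow (hxy ▸ Ideal.le_radical : maximalIdeal R ≤ _) 1 (k + 1)
  rw [maximalIdeal_pow_succ hxy,
    hk.colength_eq (Ideal.pow_le_pow_right k.le_succ (Ideal.pow_mem_pow hym _)) Submodule.mem_top,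
    colength_top, add_zero]
  have := colength_span_params hxy hy hyx 1 (k + 1)
  rw [pow_one] at this
  rw [this]
  push_cast
  ring

theorem colength_maximalIdeal_pow_ne_top (hxy : maximalIdeal R = Ideal.span {x, y})
    (hy : Prime y) (hyx : ¬ y ∣ x) (k : ℕ) : colength (maximalIdeal R ^ k) ≠ ⊤ := by
  induction k with
  | zero => simp [Ideal.one_eq_top, colength_top]
  | succ k ih =>
    rw [colength_maximalIdeal_pow_succ hxy hy hyx]
    exact WithTop.add_ne_top.2 ⟨WithTop.add_ne_top.2 ⟨ENat.natCast_ne_top k, ENat.one_ne_top⟩, ih⟩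

theorem colength_ne_top_of_le_radical (hxy : maximalIdeal R = Ideal.span {x, y})
    (hy : Prime y) (hyx : ¬ y ∣ x) {I : Ideal R} (h : maximalIdeal R ≤ I.radical) :
    colength I ≠ ⊤ := by
  obtain ⟨N, hN⟩ := Ideal.exists_pow_le_of_le_radical_of_fg h (IsNoetherian.noetherian _)
  exact ne_top_of_le_ne_top (colength_maximalIdeal_pow_ne_top hxy hy hyx N) (colength_anti hN)

theorem colength_maximalIdeal_pow_add (hxy : maximalIdeal R = Ideal.span {x, y})
    (hy : Prime y) (hyx : ¬ y ∣ x) (i j : ℕ) :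
    colength (maximalIdeal R ^ (i + j + 1)) =
      (i + 1) * (j + 1) + colength (maximalIdeal R ^ i) + colength (maximalIdeal R ^ j) := by
  induction j with
  | zero =>
    rw [add_zero, colength_maximalIdeal_pow_succ hxy hy hyx, pow_zero, Ideal.one_eq_top,
      colength_top]
    simp
  | succ j ih =>
    rw [← add_assoc, colength_maximalIdeal_pow_succ hxy hy hyx, ih,
      colength_maximalIdeal_pow_succ hxy hy hyx j]
    push_cast
    ring

end RegularParameters

section JointReduction

theorem pow_mul_pow_le_of_jointReduction {R : Type*} [CommRing R] {J K : Ideal R} {a b : R} {n : ℕ}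
    (ha : a ∈ J) (hb : b ∈ K)
    (h : (Ideal.span {a} * K + Ideal.span {b} * J) * (J * K) ^ n = (J * K) ^ (n + 1)) (p q : ℕ) :
    J ^ (n + p) * K ^ (n + q) ≤ Ideal.span {a} ^ p * (J ^ n * K ^ (n + q)) +
      Ideal.span {b} ^ q * (J ^ (n + p) * K ^ n) := by
  have ha' : Ideal.span {a} ≤ J := (Ideal.span_singleton_le_iff_mem _).2 ha
  have hb' : Ideal.span {b} ≤ K := (Ideal.span_singleton_le_iff_mem _).2 hb
  induction p generalizing q with
  | zero => simp
  | succ p ihp =>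
    induction q with
    | zero => simp
    | succ q ihq =>
      calc J ^ (n + (p + 1)) * K ^ (n + (q + 1))
          = (J * K) ^ (n + 1) * (J ^ p * K ^ q) := by ring
        _ = Ideal.span {a} * (J ^ (n + p) * K ^ (n + (q + 1))) +
            Ideal.span {b} * (J ^ (n + (p + 1)) * K ^ (n + q)) := by rw [← h]; ring
        _ ≤ Ideal.span {a} * (Ideal.span {a} ^ p * (J ^ n * K ^ (n + (q + 1))) +
              Ideal.span {b} ^ (q + 1) * (J ^ (n + p) * K ^ n)) +
            Ideal.span {b} * (Ideal.span {a} ^ (p + 1) * (J ^ n * K ^ (n + q)) +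
              Ideal.span {b} ^ q * (J ^ (n + (p + 1)) * K ^ n)) :=
            sup_le_sup (Ideal.mul_mono_right (ihp (q + 1))) (Ideal.mul_mono_right ihq)
        _ = Ideal.span {a} ^ (p + 1) * (J ^ n * K ^ (n + (q + 1))) +
              Ideal.span {a} * (Ideal.span {b} ^ (q + 1) * (J ^ (n + p) * K ^ n)) +
            (Ideal.span {b} * (Ideal.span {a} ^ (p + 1) * (J ^ n * K ^ (n + q))) +
              Ideal.span {b} ^ (q + 1) * (J ^ (n + (p + 1)) * K ^ n)) := by ring
        _ ≤ _ := by
            refine sup_le (sup_le le_sup_left (le_sup_of_le_right ?_))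
              (sup_le (le_sup_of_le_left ?_) le_sup_right)
            · calc _ ≤ J * (Ideal.span {b} ^ (q + 1) * (J ^ (n + p) * K ^ n)) :=
                    Ideal.mul_mono_left ha'
                _ = _ := by ring
            · calc _ ≤ K * (Ideal.span {a} ^ (p + 1) * (J ^ n * K ^ (n + q))) :=
                    Ideal.mul_mono_left hb'
                _ = _ := by ring

theorem le_radical_of_jointReduction {R : Type*} [CommRing R] {I J K : Ideal R} {a b : R} {n : ℕ}
    (hJ : I ≤ J.radical) (hK : I ≤ K.radical)
    (h : (Ideal.span {a} * K + Ideal.span {b} * J) * (J * K) ^ n = (J * K) ^ (n + 1)) :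
    I ≤ (Ideal.span {a, b}).radical := by
  have h1 : (J * K) ^ (n + 1) ≤ Ideal.span {a, b} := by
    rw [← h]
    exact Ideal.mul_le_left.trans (span_mul_add_le_span_pair a b K J)
  calc I ≤ J.radical ⊓ K.radical := le_inf hJ hK
    _ = (J * K).radical := (Ideal.radical_mul J K).symm
    _ = ((J * K) ^ (n + 1)).radical := (Ideal.radical_pow _ n.succ_ne_zero).symm
    _ ≤ _ := Ideal.radical_mono h1

theorem Nat.le_of_forall_sq_mul_le {e e' n C : ℕ}
    (h : ∀ M : ℕ, M ^ 2 * e ≤ (n + M) ^ 2 * e' + C) : e ≤ e' := by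
  by_contra! hlt
  obtain ⟨d, rfl⟩ := Nat.exists_eq_add_of_lt hlt
  have := h (2 * n * e' + n ^ 2 * e' + C + 1)
  set M := 2 * n * e' + n ^ 2 * e' + C + 1 with hM
  have h1 : M * M = 2 * n * e' * M + (n ^ 2 * e' + C + 1) * M := by
    conv_lhs => lhs; rw [hM]
    ring
  have h2 : (n ^ 2 * e' + C + 1) * 1 ≤ (n ^ 2 * e' + C + 1) * M :=
    Nat.mul_le_mul_left _ (by omega)
  nlinarith [Nat.zero_le (M ^ 2 * d)]

variable {R : Type*} [CommRing R] [IsDomain R] [IsLocalRing R] [IsNoetherianRing R] {x y : R}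

/-- A joint reduction of `J, K` minimizes `λ(R/(a, b))` among systems of parameters
`a ∈ J, b ∈ K`. -/
theorem colength_span_pair_le_of_jointReduction (hxy : maximalIdeal R = Ideal.span {x, y})
    (hy : Prime y) (hyx : ¬ y ∣ x) {J K : Ideal R} (hJ : maximalIdeal R ≤ J.radical)
    (hK : maximalIdeal R ≤ K.radical) {a b a' b' : R} {n : ℕ} (ha : a ∈ J) (hb : b ∈ K)
    (h : (Ideal.span {a} * K + Ideal.span {b} * J) * (J * K) ^ n = (J * K) ^ (n + 1))
    (ha' : a' ∈ J) (hb' : b' ∈ K) (h' : maximalIdeal R ≤ (Ideal.span {a', b'}).radical) :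
    colength (Ideal.span {a, b}) ≤ colength (Ideal.span {a', b'}) := by
  have hab := le_radical_of_jointReduction hJ hK h
  have hpow : ∀ {I : Ideal R}, maximalIdeal R ≤ I.radical → ∀ k, maximalIdeal R ≤ (I ^ k).radical :=
    fun {I} hI k => by
      rcases Nat.eq_zero_or_pos k with rfl | hk
      · simp [Ideal.one_eq_top, Ideal.radical_top]
      · rwa [Ideal.radical_pow _ hk.ne']
  have hW : maximalIdeal R ≤ (J ^ n * K ^ n).radical := by
    rw [Ideal.radical_mul]
    exact le_inf (hpow hJ n) (hpow hK n)
  have fin : ∀ {I : Ideal R}, maximalIdeal R ≤ I.radical → ∃ l : ℕ, colength I = l := fun hI =>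
    ⟨_, (ENat.natCast_toNat (colength_ne_top_of_le_radical hxy hy hyx hI)).symm⟩
  obtain ⟨e, he⟩ := fin hab
  obtain ⟨e', he'⟩ := fin h'
  obtain ⟨C, hC⟩ := fin hW
  rw [he, he', Nat.cast_le]
  refine Nat.le_of_forall_sq_mul_le (n := n) (C := C) fun M => ?_
  obtain ⟨j, hj⟩ := fin (hpow hJ (n + M))
  obtain ⟨k, hk⟩ := fin (hpow hK (n + M))
  have hreg := onlyKoszulRelations_of_le_radical hxy hy hyx (le_radical_span_pow_pow hab M M)
  have hreg' := onlyKoszulRelations_of_le_radical hxy hy hyx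
    (le_radical_span_pow_pow h' (n + M) (n + M))
  have lower := hreg.colength_add_le (U := J ^ n * K ^ (n + M)) (V := J ^ (n + M) * K ^ n)
    (W := J ^ n * K ^ n)
    (fun w hw => by
      rw [pow_add, mul_comm (K ^ n), mul_left_comm]
      exact Ideal.mul_mem_mul (Ideal.pow_mem_pow hb M) hw)
    (fun w hw => by
      rw [pow_add, mul_comm (J ^ n), mul_assoc]
      exact Ideal.mul_mem_mul (Ideal.pow_mem_pow ha M) hw)
  have upper := hreg'.colength_eq (U := K ^ (n + M)) (V := J ^ (n + M))
    (Ideal.pow_mem_pow hb' _) (Ideal.pow_mem_pow ha' _)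
  have h1 : colength (K ^ (n + M)) ≤ colength (J ^ n * K ^ (n + M)) :=
    colength_anti Ideal.mul_le_right
  have h2 : colength (J ^ (n + M)) ≤ colength (J ^ (n + M) * K ^ n) :=
    colength_anti Ideal.mul_le_left
  have h3 := colength_anti (pow_mul_pow_le_of_jointReduction ha hb h M M)
  have h4 : colength (J ^ (n + M) * K ^ (n + M)) ≤
      colength (Ideal.span {a' ^ (n + M)} * K ^ (n + M) +
        Ideal.span {b' ^ (n + M)} * J ^ (n + M)) := by
    refine colength_anti (sup_le ?_ ?_)
    · exact Ideal.mul_mono_left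
        ((Ideal.span_singleton_le_iff_mem _).2 (Ideal.pow_mem_pow ha' _))
    · rw [mul_comm]
      exact Ideal.mul_mono_right
        ((Ideal.span_singleton_le_iff_mem _).2 (Ideal.pow_mem_pow hb' _))
  rw [colength_span_pow_pow hxy hy hyx hab, he, hC] at lower
  rw [colength_span_pow_pow hxy hy hyx h', he', hj, hk] at upper
  rw [Ideal.span_singleton_pow, Ideal.span_singleton_pow] at h3
  rw [hk] at h1
  rw [hj] at h2
  have key : ((M * M * e + k + j : ℕ) : ℕ∞) ≤ (((n + M) * (n + M) * e' + k + j + C : ℕ) : ℕ∞) := by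
    calc ((M * M * e + k + j : ℕ) : ℕ∞) = (M : ℕ∞) * M * e + k + j := by push_cast; rfl
      _ ≤ _ := add_le_add (add_le_add le_rfl h1) h2
      _ ≤ _ := lower
      _ ≤ _ := add_le_add (h3.trans h4) le_rfl
      _ = _ := by rw [upper]; push_cast; rfl
  have := Nat.cast_le.1 key
  rw [sq, sq]
  omega

end JointReduction

/-- Over a local ring with infinite residue field, an ideal is not the union of finitely many
proper subideals. -/
theorem exists_mem_forall_notMem {R : Type*} [CommRing R] [IsLocalRing R]
    [Infinite (ResidueField R)] {J : Ideal R} {S : Set (Ideal R)} (hS : S.Finite)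
    (h : ∀ N ∈ S, ¬ J ≤ N) : ∃ a ∈ J, ∀ N ∈ S, a ∉ N := by
  induction S, hS using Set.Finite.induction_on with
  | empty => exact ⟨0, J.zero_mem, by simp⟩
  | @insert N S hN hS ih =>
    obtain ⟨a, haJ, ha⟩ := ih fun N' hN' => h N' (Set.mem_insert_of_mem _ hN')
    by_cases haN : a ∈ N
    · obtain ⟨b, hbJ, hbN⟩ := SetLike.not_le_iff_exists.1 (h N (Set.mem_insert _ _))
      have hfin : (⋃ N' ∈ S, {ρ : ResidueField R | ∃ r, residue R r = ρ ∧ b + r * a ∈ N'}).Finite := by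
        refine hS.biUnion fun N' hN' => Set.Subsingleton.finite ?_
        rintro _ ⟨r, rfl, hr⟩ _ ⟨r', rfl, hr'⟩
        by_contra hne
        have hu : IsUnit (r - r') := by
          rw [← sub_eq_zero, ← map_sub, residue_eq_zero_iff, mem_maximalIdeal,
            mem_nonunits_iff, not_not] at hne
          exact hne
        refine ha N' hN' ((Ideal.unit_mul_mem_iff_mem N' hu).1 ?_)
        have := N'.sub_mem hr hr'
        rwa [show b + r * a - (b + r' * a) = (r - r') * a by ring] at this
      obtain ⟨ρ, hρ⟩ := hfin.exists_notMem
      obtain ⟨r, rfl⟩ := residue_surjective ρ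
      refine ⟨b + r * a, J.add_mem hbJ (J.mul_mem_left _ haJ), ?_⟩
      rintro N' (rfl | hN') hmem
      · exact hbN ((Ideal.add_mem_iff_left _ (N'.mul_mem_left _ haN)).1 hmem)
      · exact hρ (Set.mem_biUnion hN' ⟨r, rfl, hmem⟩)
    · refine ⟨a, haJ, ?_⟩
      rintro N' (rfl | hN')
      · exact haN
      · exact ha N' hN'

section ReesHom

variable {R : Type*} [CommRing R] {ι : Type*}

/-- The presentation `X i ↦ f i * T` of the Rees algebra of the ideal generated by `f`. -/
noncomputable def reesHom (f : ι → R) : MvPolynomial ι R →ₐ[R] Polynomial R :=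
  MvPolynomial.aeval fun i => Polynomial.C (f i) * Polynomial.X

/-- The map sending `X i` to `f i * T` for `i ∈ S` and to an independent variable otherwise. -/
noncomputable def partialReesHom [DecidableEq ι] (f : ι → R) (S : Finset ι) :
    MvPolynomial ι R →ₐ[R] MvPolynomial (Option ι) R :=
  MvPolynomial.aeval fun i =>
    if i ∈ S then MvPolynomial.C (f i) * MvPolynomial.X none else MvPolynomial.X (some i)

theorem ker_partialReesHom_lt [DecidableEq ι] {f : ι → R} {S : Finset ι} {i₀ i : ι} (h0 : i₀ ∈ S)
    (hf : f i₀ ≠ 0) (hi : i ∉ S) :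
    RingHom.ker (partialReesHom f S) < RingHom.ker (partialReesHom f (insert i S)) := by
  refine lt_of_le_of_ne ?_ ?_
  · have hcomp : partialReesHom f (insert i S) =
        (MvPolynomial.aeval fun j : Option ι =>
          if j = some i then MvPolynomial.C (f i) * MvPolynomial.X none
          else MvPolynomial.X j : MvPolynomial (Option ι) R →ₐ[R] MvPolynomial (Option ι) R).comp
        (partialReesHom f S) := by
      refine MvPolynomial.algHom_ext fun j => ?_
      by_cases hj : j = i
      · subst hj
        simp [partialReesHom, hi]
      · by_cases hjS : j ∈ S <;> simp [partialReesHom, hj, hjS, MvPolynomial.algHom_C]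
    intro F hF
    rw [RingHom.mem_ker] at hF ⊢
    rw [hcomp, AlgHom.comp_apply, hF, map_zero]
  · intro heq
    have hmem : MvPolynomial.C (f i₀) * MvPolynomial.X i - MvPolynomial.C (f i) * MvPolynomial.X i₀ ∈
        RingHom.ker (partialReesHom f (insert i S)) := by
      rw [RingHom.mem_ker]
      simp [partialReesHom, h0, MvPolynomial.algHom_C]
      ring
    rw [← heq, RingHom.mem_ker] at hmem
    have := congrArg (MvPolynomial.eval fun j : Option ι => if j = some i then (1 : R) else 0) hmem
    simp [partialReesHom, h0, hi, MvPolynomial.algHom_C] at this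
    exact hf this

theorem card_le_height_ker_partialReesHom [IsDomain R] [DecidableEq ι] {f : ι → R} {i₀ : ι}
    (hf : f i₀ ≠ 0) (S : Finset ι) (hS : i₀ ∉ S) :
    (S.card : ℕ∞) ≤ (RingHom.ker (partialReesHom f (insert i₀ S))).height := by
  induction S using Finset.induction_on with
  | empty => simp
  | insert i S hi ih =>
    rw [Finset.mem_insert, not_or] at hS
    have hlt := ker_partialReesHom_lt (Finset.mem_insert_self i₀ S) hf
      (i := i) (by simp [hi, Ne.symm hS.1])
    rw [Finset.insert_comm, Finset.card_insert_of_notMem hi]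
    have := RingHom.ker_isPrime (partialReesHom f (insert i₀ S))
    have := RingHom.ker_isPrime (partialReesHom f (insert i (insert i₀ S)))
    push_cast
    exact (add_le_add (ih hS.2) le_rfl).trans (Ideal.height_add_one_le_of_lt_of_isPrime hlt)

theorem card_le_height_ker_reesHom_add_one [IsDomain R] [Fintype ι] {f : ι → R} {i₀ : ι}
    (hf : f i₀ ≠ 0) : (Fintype.card ι : ℕ∞) ≤ (RingHom.ker (reesHom f)).height + 1 := by
  classical
  have hcomp : reesHom f = (MvPolynomial.aeval fun j : Option ι =>
      j.elim Polynomial.X fun _ => 0 : MvPolynomial (Option ι) R →ₐ[R] Polynomial R).comp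
        (partialReesHom f Finset.univ) := by
    refine MvPolynomial.algHom_ext fun j => ?_
    simp [partialReesHom, reesHom, MvPolynomial.algHom_C]
  have hle : RingHom.ker (partialReesHom f Finset.univ) ≤ RingHom.ker (reesHom f) := by
    intro F hF
    rw [RingHom.mem_ker] at hF ⊢
    rw [hcomp, AlgHom.comp_apply, hF, map_zero]
  have h1 := card_le_height_ker_partialReesHom hf (Finset.univ.erase i₀) (Finset.notMem_erase _ _)
  rw [Finset.insert_erase (Finset.mem_univ _)] at h1
  calc (Fintype.card ι : ℕ∞) = ((Finset.univ.erase i₀).card : ℕ∞) + 1 := by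
        rw [← Nat.cast_one, ← Nat.cast_add, Finset.card_erase_add_one (Finset.mem_univ _),
          Finset.card_univ]
    _ ≤ _ := add_le_add (h1.trans (Ideal.height_mono hle)) le_rfl

/-- In the polynomial ring over a two-dimensional Noetherian domain, there are no chains of
length four starting at the defining ideal of a Rees algebra. -/
theorem not_chain_of_ker_reesHom_lt [IsDomain R] [IsNoetherianRing R] (hdim : ringKrullDim R = 2)
    [Fintype ι] {f : ι → R} {i₀ : ι} (hf : f i₀ ≠ 0) {P Q P' M : Ideal (MvPolynomial ι R)}
    [P.IsPrime] [Q.IsPrime] [P'.IsPrime] [M.IsPrime] (h0 : RingHom.ker (reesHom f) < P)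
    (h1 : P < Q) (h2 : Q < P') (h3 : P' < M) : False := by
  have := RingHom.ker_isPrime (reesHom f)
  have e0 := Ideal.height_add_one_le_of_lt_of_isPrime h0
  have e1 := Ideal.height_add_one_le_of_lt_of_isPrime h1
  have e2 := Ideal.height_add_one_le_of_lt_of_isPrime h2
  have e3 := Ideal.height_add_one_le_of_lt_of_isPrime h3
  have e4 := card_le_height_ker_reesHom_add_one hf
  have e5 := Ideal.height_le_ringKrullDim_of_isPrime (I := M)
  rw [MvPolynomial.ringKrullDim_of_isNoetherianRing, hdim, Nat.card_eq_fintype_card] at e5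
  have e6 : (M.height : ℕ∞) ≤ 2 + Fintype.card ι :=
    WithBot.coe_le_coe.1 (e5.trans_eq (by push_cast; rfl))
  have e7 : (Fintype.card ι : ℕ∞) + 3 ≤ 2 + Fintype.card ι := by
    calc (Fintype.card ι : ℕ∞) + 3 ≤ P.height + 3 := add_le_add (e4.trans e0) le_rfl
      _ = P.height + 1 + 1 + 1 := by norm_num [add_assoc]
      _ ≤ M.height := by
        refine le_trans ?_ e3
        gcongr
        refine le_trans ?_ e2
        gcongr
      _ ≤ _ := e6
  have e8 : Fintype.card ι + 3 ≤ 2 + Fintype.card ι := by exact_mod_cast e7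
  omega

end ReesHom

section ReesIdeals

variable {R : Type*} [CommRing R] {ι : Type*}

theorem coeff_zero_reesHom (f : ι → R) (G : MvPolynomial ι R) :
    (reesHom f G).coeff 0 = MvPolynomial.constantCoeff G := by
  have : (Polynomial.constantCoeff.comp (reesHom f : MvPolynomial ι R →+* Polynomial R)) =
      MvPolynomial.constantCoeff :=
    MvPolynomial.ringHom_ext (by simp [reesHom]) (by simp [reesHom])
  exact DFunLike.congr_fun this G

theorem coeff_reesHom_mem (f : ι → R) (G : MvPolynomial ι R) (n : ℕ) :
    (reesHom f G).coeff n ∈ Ideal.span (Set.range f) ^ n := by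
  suffices reesHom f G ∈ reesAlgebra (Ideal.span (Set.range f)) from this n
  induction G using MvPolynomial.induction_on with
  | C a =>
    rw [MvPolynomial.algHom_C]
    exact Subalgebra.algebraMap_mem _ a
  | add p q hp hq => rw [map_add]; exact add_mem hp hq
  | mul_X p i hp =>
    rw [map_mul]
    refine mul_mem hp ?_
    rw [reesHom, MvPolynomial.aeval_X, Polynomial.C_mul_X_eq_monomial,
      reesAlgebra.monomial_mem, pow_one]
    exact Ideal.subset_span ⟨i, rfl⟩

theorem exists_reesHom_eq_of_mem {f : ι → R} {g : R} (hg : g ∈ Ideal.span (Set.range f)) :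
    ∃ G ∈ Ideal.span (Set.range (MvPolynomial.X : ι → MvPolynomial ι R)),
      reesHom f G = Polynomial.C g * Polynomial.X := by
  induction hg using Submodule.span_induction with
  | mem g hg =>
    obtain ⟨i, rfl⟩ := hg
    exact ⟨MvPolynomial.X i, Ideal.subset_span ⟨i, rfl⟩, by simp [reesHom]⟩
  | zero => exact ⟨0, Ideal.zero_mem _, by simp⟩
  | add g g' _ _ h h' =>
    obtain ⟨G, hG, hG'⟩ := h
    obtain ⟨H, hH, hH'⟩ := h'
    exact ⟨G + H, Ideal.add_mem _ hG hH, by rw [map_add, hG', hH', map_add, add_mul]⟩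
  | smul c g _ h =>
    obtain ⟨G, hG, hG'⟩ := h
    refine ⟨MvPolynomial.C c * G, Ideal.mul_mem_left _ _ hG, ?_⟩
    rw [map_mul, MvPolynomial.algHom_C, hG', smul_eq_mul, map_mul, Polynomial.algebraMap_eq,
      mul_assoc]

theorem exists_reesHom_eq_of_mem_pow {f : ι → R} {n : ℕ} {g : R}
    (hg : g ∈ Ideal.span (Set.range f) ^ n) :
    ∃ G ∈ Ideal.span (Set.range (MvPolynomial.X : ι → MvPolynomial ι R)) ^ n,
      reesHom f G = Polynomial.C g * Polynomial.X ^ n := by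
  induction n generalizing g with
  | zero => exact ⟨MvPolynomial.C g, by simp, by simp [MvPolynomial.algHom_C]⟩
  | succ n ih =>
    rw [pow_succ] at hg
    induction hg using Submodule.mul_induction_on' with
    | mem_mul_mem u hu v hv =>
      obtain ⟨G, hG, hG'⟩ := ih hu
      obtain ⟨H, hH, hH'⟩ := exists_reesHom_eq_of_mem hv
      refine ⟨G * H, by rw [pow_succ]; exact Ideal.mul_mem_mul hG hH, ?_⟩
      rw [map_mul, hG', hH', map_mul]
      ring
    | add u _ v _ h h' =>
      obtain ⟨G, hG, hG'⟩ := h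
      obtain ⟨H, hH, hH'⟩ := h'
      exact ⟨G + H, Ideal.add_mem _ hG hH, by rw [map_add, hG', hH', map_add, add_mul]⟩

/-- The ideal of polynomials whose image in the Rees algebra lies in `⨁ W n * T ^ n`. -/
noncomputable def filtrationIdeal (f : ι → R) (W : ℕ → Ideal R)
    (hW : ∀ i j, Ideal.span (Set.range f) ^ i * W j ≤ W (i + j)) : Ideal (MvPolynomial ι R) where
  carrier := {G | ∀ n, (reesHom f G).coeff n ∈ W n}
  add_mem' hG hH n := by
    rw [map_add, Polynomial.coeff_add]
    exact Ideal.add_mem _ (hG n) (hH n)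
  zero_mem' n := by simp
  smul_mem' H G hG n := by
    rw [smul_eq_mul, map_mul, Polynomial.coeff_mul]
    refine Ideal.sum_mem _ fun p hp => ?_
    have hpn : p.1 + p.2 = n := by simpa using hp
    subst hpn
    exact hW _ _ (Ideal.mul_mem_mul (coeff_reesHom_mem f H p.1) (hG p.2))

/-- The ideal of those `g` such that `g * T` is the image of an element of `P`. -/
noncomputable def formIdeal (f : ι → R) (P : Ideal (MvPolynomial ι R)) : Ideal R where
  carrier := {g | ∃ G ∈ P, reesHom f G = Polynomial.C g * Polynomial.X}
  add_mem' := by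
    rintro g g' ⟨G, hG, hG'⟩ ⟨H, hH, hH'⟩
    exact ⟨G + H, Ideal.add_mem _ hG hH, by rw [map_add, hG', hH', map_add, add_mul]⟩
  zero_mem' := ⟨0, P.zero_mem, by simp⟩
  smul_mem' := by
    rintro c g ⟨G, hG, hG'⟩
    refine ⟨MvPolynomial.C c * G, Ideal.mul_mem_left _ _ hG, ?_⟩
    rw [map_mul, MvPolynomial.algHom_C, hG', smul_eq_mul, map_mul, Polynomial.algebraMap_eq,
      mul_assoc]

/-- The ideal generated by the polynomials with image `g * T`, `g ∈ L`. -/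
noncomputable def formSpan (f : ι → R) (L : Ideal R) : Ideal (MvPolynomial ι R) :=
  Ideal.span {G | ∃ g ∈ L, reesHom f G = Polynomial.C g * Polynomial.X}

theorem formIdeal_mono (f : ι → R) {P Q : Ideal (MvPolynomial ι R)} (h : P ≤ Q) :
    formIdeal f P ≤ formIdeal f Q := fun _ ⟨G, hG, hG'⟩ => ⟨G, h hG, hG'⟩

theorem mem_formIdeal_iff {f : ι → R} {P : Ideal (MvPolynomial ι R)}
    (hP : RingHom.ker (reesHom f) ≤ P) {g : R} {G : MvPolynomial ι R}
    (h : reesHom f G = Polynomial.C g * Polynomial.X) : g ∈ formIdeal f P ↔ G ∈ P := by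
  refine ⟨?_, fun hG => ⟨G, hG, h⟩⟩
  rintro ⟨H, hH, hH'⟩
  have : G - H ∈ P := hP (by rw [RingHom.mem_ker, map_sub, h, hH', sub_self])
  exact (Submodule.sub_mem_iff_left _ hH).1 this

theorem formSpan_le_iff {f : ι → R} {P : Ideal (MvPolynomial ι R)}
    (hP : RingHom.ker (reesHom f) ≤ P) {L : Ideal R} (hL : L ≤ Ideal.span (Set.range f)) :
    formSpan f L ≤ P ↔ L ≤ formIdeal f P := by
  constructor
  · intro h g hg
    obtain ⟨G, -, hG⟩ := exists_reesHom_eq_of_mem (hL hg)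
    exact (mem_formIdeal_iff hP hG).2 (h (Ideal.subset_span ⟨g, hg, hG⟩))
  · intro h
    refine Ideal.span_le.2 ?_
    rintro G ⟨g, hg, hG⟩
    exact (mem_formIdeal_iff hP hG).1 (h hg)

theorem X_mem_of_le_formIdeal {f : ι → R} {P : Ideal (MvPolynomial ι R)}
    (hP : RingHom.ker (reesHom f) ≤ P) (h : Ideal.span (Set.range f) ≤ formIdeal f P) (i : ι) :
    MvPolynomial.X i ∈ P :=
  (mem_formIdeal_iff hP (by simp [reesHom])).1 (h (Ideal.subset_span ⟨i, rfl⟩))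

variable [IsLocalRing R]

/-- The defining ideal of the fiber cone. -/
noncomputable def fiberIdeal (f : ι → R) : Ideal (MvPolynomial ι R) :=
  RingHom.ker (reesHom f) ⊔ (maximalIdeal R).map MvPolynomial.C

/-- The polynomials whose constant coefficient is not a unit. -/
noncomputable def irrelevantIdeal (R : Type*) [CommRing R] [IsLocalRing R] (ι : Type*) :
    Ideal (MvPolynomial ι R) :=
  (maximalIdeal R).comap MvPolynomial.constantCoeff

instance : (irrelevantIdeal R ι).IsPrime := Ideal.comap_isPrime _ _

theorem X_mem_irrelevantIdeal (i : ι) : MvPolynomial.X i ∈ irrelevantIdeal R ι := by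
  simp [irrelevantIdeal]

theorem ker_le_fiberIdeal (f : ι → R) : RingHom.ker (reesHom f) ≤ fiberIdeal f := le_sup_left

end ReesIdeals

section Reductions

variable {R : Type*} [CommRing R] [IsLocalRing R] [IsNoetherianRing R] {ι : Type*} [Finite ι]

/-- An ideal `L ≤ I` with `V(L)` empty in the projectivized fiber cone is a reduction of `I`. -/
theorem exists_mul_pow_eq_of_forall_prime {f : ι → R} {I L : Ideal R}
    (hI : Ideal.span (Set.range f) = I) (hL : L ≤ I)
    (h : ∀ P : Ideal (MvPolynomial ι R), P.IsPrime → fiberIdeal f ≤ P → P ≤ irrelevantIdeal R ι →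
      L ≤ formIdeal f P → I ≤ formIdeal f P) : ∃ n, L * I ^ n = I ^ (n + 1) := by
  subst hI
  set I := Ideal.span (Set.range f) with hI
  let b := fiberIdeal f ⊔ formSpan f L
  have h1 : ∀ i, ∃ k : ℕ, ∃ F ∉ irrelevantIdeal R ι, MvPolynomial.X i ^ k * F ∈ b := by
    intro i
    by_contra! hcon
    have hdisj : Disjoint (b : Set (MvPolynomial ι R))
        (Submonoid.powers (MvPolynomial.X i) ⊔ (irrelevantIdeal R ι).primeCompl :
          Submonoid (MvPolynomial ι R)) := by
      rw [Set.disjoint_left]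
      intro G hG hG'
      obtain ⟨_, ⟨k, rfl⟩, F, hF, rfl⟩ := Submonoid.mem_sup.1 hG'
      exact hcon k F hF hG
    obtain ⟨P, hP, hbP, hPd⟩ := Ideal.exists_le_prime_disjoint b _ hdisj
    have hker : RingHom.ker (reesHom f) ≤ P :=
      (ker_le_fiberIdeal f).trans (le_sup_left.trans hbP)
    have hPM : P ≤ irrelevantIdeal R ι := by
      intro G hG
      by_contra hGM
      exact Set.disjoint_left.1 hPd hG (Submonoid.mem_sup_right (S := Submonoid.powers _) hGM)
    refine Set.disjoint_left.1 hPd ?_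
      (Submonoid.mem_sup_left (T := (irrelevantIdeal R ι).primeCompl)
        (Submonoid.mem_powers (MvPolynomial.X i)))
    exact X_mem_of_le_formIdeal hker (h P hP (le_sup_left.trans hbP) hPM
      ((formSpan_le_iff hker hL).1 (le_sup_right.trans hbP))) i
  choose k F hF hkF using h1
  have := Fintype.ofFinite ι
  have hprod : ∏ i, F i ∉ irrelevantIdeal R ι := by
    rw [Ideal.IsPrime.prod_mem_iff]
    rintro ⟨i, -, hi⟩
    exact hF i hi
  have hrad : Ideal.span (Set.range (MvPolynomial.X : ι → MvPolynomial ι R)) ≤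
      (Submodule.colon b {∏ i, F i}).radical := by
    refine Ideal.span_le.2 ?_
    rintro _ ⟨i, rfl⟩
    refine ⟨k i, Submodule.mem_colon_singleton.2 ?_⟩
    obtain ⟨c, hc⟩ := Finset.dvd_prod_of_mem F (Finset.mem_univ i)
    rw [smul_eq_mul, hc, ← mul_assoc]
    exact Ideal.mul_mem_right _ _ (hkF i)
  obtain ⟨N, hN⟩ := Ideal.exists_pow_le_of_le_radical_of_fg hrad
    (Submodule.fg_span (Set.finite_range _))
  let W : ℕ → Ideal R := fun n => match n with
    | 0 => maximalIdeal R
    | n + 1 => L * I ^ n + maximalIdeal R * I ^ (n + 1)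
  have hW : ∀ i j, I ^ i * W j ≤ W (i + j) := by
    rintro i (_ | j)
    · rcases i with _ | i
      · simp
      · change I ^ (i + 1) * maximalIdeal R ≤ L * I ^ i + maximalIdeal R * I ^ (i + 1)
        rw [mul_comm]
        exact le_sup_right
    · refine le_of_eq ?_
      change I ^ i * (L * I ^ j + maximalIdeal R * I ^ (j + 1)) =
        L * I ^ (i + j) + maximalIdeal R * I ^ (i + j + 1)
      ring
  have hbW : b ≤ filtrationIdeal f W hW := by
    refine sup_le (sup_le ?_ ?_) (Ideal.span_le.2 ?_)
    · intro G hG n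
      rw [(RingHom.mem_ker).1 hG, Polynomial.coeff_zero]
      exact Ideal.zero_mem _
    · refine Ideal.map_le_iff_le_comap.2 fun c hc n => ?_
      rw [MvPolynomial.algHom_C, Polynomial.algebraMap_eq, Polynomial.coeff_C]
      rcases n with _ | n
      · exact hc
      · simp
    · rintro G ⟨g, hg, hG⟩ n
      rw [hG, Polynomial.coeff_C_mul_X]
      split_ifs with hn
      · subst hn
        change g ∈ L * I ^ 0 + maximalIdeal R * I ^ (0 + 1)
        rw [pow_zero, mul_one]
        exact Ideal.mem_sup_left hg
      · exact Ideal.zero_mem _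
  have hle : I ^ (N + 1) ≤ L * I ^ N ⊔ maximalIdeal R • I ^ (N + 1) := by
    intro g hg
    obtain ⟨G, hG, hG'⟩ := exists_reesHom_eq_of_mem_pow hg
    have h2 := hbW (Submodule.mem_colon_singleton.1 (hN (Ideal.pow_le_pow_right N.le_succ hG)))
      (N + 1)
    rw [smul_eq_mul, mul_comm, map_mul, hG', ← mul_assoc, Polynomial.coeff_mul_X_pow',
      if_pos le_rfl, Nat.sub_self, Polynomial.coeff_mul_C, coeff_zero_reesHom] at h2
    have hu : IsUnit (MvPolynomial.constantCoeff (∏ i, F i)) := by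
      by_contra hu
      exact hprod hu
    exact (Ideal.unit_mul_mem_iff_mem _ hu).1 h2
  refine ⟨N, le_antisymm ?_ ?_⟩
  · rw [pow_succ']
    exact Ideal.mul_mono_left hL
  · exact Submodule.le_of_le_smul_of_le_jacobson_bot (IsNoetherian.noetherian _)
      (maximalIdeal_le_jacobson ⊥) hle

end Reductions

section Existence

variable {R : Type*} [CommRing R] [IsLocalRing R]

theorem maximalIdeal_ne_bot_of_ringKrullDim_eq_two (hdim : ringKrullDim R = 2) :
    maximalIdeal R ≠ ⊥ := by
  intro h
  have := ringKrullDim_eq_zero_of_isField (isField_iff_maximalIdeal_eq.2 h)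
  rw [hdim] at this
  exact absurd this (by decide)

theorem exists_mem_not_span_mul_le [Infinite (ResidueField R)] {J U : Ideal R}
    {S : Set (Ideal R)} (hS : S.Finite) (h : ∀ D ∈ S, ¬ J * U ≤ D) :
    ∃ a ∈ J, ∀ D ∈ S, ¬ Ideal.span {a} * U ≤ D := by
  obtain ⟨a, haJ, ha⟩ := exists_mem_forall_notMem (J := J)
    (hS.image fun D => Submodule.colon D (U : Set R)) (by
      rintro _ ⟨D, hD, rfl⟩ hJ
      refine h D hD (Ideal.mul_le.2 fun z hz u hu => ?_)
      exact Submodule.mem_colon.1 (hJ hz) u hu)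
  refine ⟨a, haJ, fun D hD hle => ha _ ⟨D, hD, rfl⟩ (Submodule.mem_colon.2 fun u hu => ?_)⟩
  exact hle (Ideal.mul_mem_mul (Ideal.mem_span_singleton_self a) hu)

variable [IsDomain R] [IsNoetherianRing R]

/-- Existence of `a ∈ J`, `b ∈ K` such that `aU + bV` is a reduction of `JU + KV`. -/
theorem exists_reduction_span_mul_add [Infinite (ResidueField R)] (hdim : ringKrullDim R = 2)
    {ι : Type*} [Fintype ι] {f : ι → R} {i₀ : ι} (hf : f i₀ ≠ 0) {I J K U V : Ideal R}
    (hfI : Ideal.span (Set.range f) = I) (hI : J * U ⊔ K * V = I)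
    (h : ∀ P ∈ (fiberIdeal f).minimalPrimes, P ≤ irrelevantIdeal R ι → ¬ I ≤ formIdeal f P →
      ¬ J * U ≤ formIdeal f P ∧ ¬ K * V ≤ formIdeal f P) :
    ∃ a ∈ J, ∃ b ∈ K, ∃ n,
      (Ideal.span {a} * U + Ideal.span {b} * V) * I ^ n = I ^ (n + 1) := by
  have hJU : J * U ≤ Ideal.span (Set.range f) := by rw [hfI, ← hI]; exact le_sup_left
  have hKV : K * V ≤ Ideal.span (Set.range f) := by rw [hfI, ← hI]; exact le_sup_right
  have hlt : RingHom.ker (reesHom f) < fiberIdeal f := by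
    refine lt_of_le_of_ne (ker_le_fiberIdeal f) fun heq => ?_
    obtain ⟨c, hc, hc0⟩ := Submodule.exists_mem_ne_zero_of_ne_bot
      (maximalIdeal_ne_bot_of_ringKrullDim_eq_two hdim)
    have : MvPolynomial.C c ∈ RingHom.ker (reesHom f) := by
      rw [heq]
      exact Ideal.mem_sup_right (Ideal.mem_map_of_mem _ hc)
    rw [RingHom.mem_ker, MvPolynomial.algHom_C, Polynomial.algebraMap_eq,
      Polynomial.C_eq_zero] at this
    exact hc0 this
  have hirr : ∀ {P : Ideal (MvPolynomial ι R)}, fiberIdeal f ≤ P → P ≤ irrelevantIdeal R ι →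
      ¬ I ≤ formIdeal f P → P < irrelevantIdeal R ι := by
    intro P hP hPM hPI
    refine lt_of_le_of_ne hPM ?_
    rintro rfl
    refine hPI ?_
    rw [← hfI, Ideal.span_le]
    rintro _ ⟨i, rfl⟩
    exact ⟨MvPolynomial.X i, X_mem_irrelevantIdeal i, by simp [reesHom]⟩
  have hchain : ∀ {P Q P' : Ideal (MvPolynomial ι R)}, P.IsPrime → Q.IsPrime → P'.IsPrime →
      fiberIdeal f ≤ P → P < Q → Q < P' → P' < irrelevantIdeal R ι → False :=
    fun _ _ _ h0 h1 h2 h3 => not_chain_of_ker_reesHom_lt hdim hf (hlt.trans_le h0) h1 h2 h3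
  let S₁ : Set (Ideal (MvPolynomial ι R)) :=
    {P | P ∈ (fiberIdeal f).minimalPrimes ∪ (fiberIdeal f ⊔ formSpan f (K * V)).minimalPrimes ∧
      P ≤ irrelevantIdeal R ι ∧ ¬ I ≤ formIdeal f P}
  have hS₁ : S₁.Finite := ((Ideal.finite_minimalPrimes_of_isNoetherianRing _ _).union
    (Ideal.finite_minimalPrimes_of_isNoetherianRing _ _)).subset fun P hP => hP.1
  obtain ⟨a, haJ, ha⟩ := exists_mem_not_span_mul_le (J := J) (U := U) (hS₁.image (formIdeal f)) (by
    rintro _ ⟨P, ⟨hP | hP, hPM, hPI⟩, rfl⟩ hle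
    · exact (h P hP hPM hPI).1 hle
    · have hPf := le_sup_left.trans hP.1.2
      refine hPI (hI ▸ sup_le hle ?_)
      exact (formSpan_le_iff ((ker_le_fiberIdeal f).trans hPf) hKV).1 (le_sup_right.trans hP.1.2))
  have haU : Ideal.span {a} * U ≤ Ideal.span (Set.range f) :=
    (Ideal.mul_mono_left ((Ideal.span_singleton_le_iff_mem _).2 haJ)).trans hJU
  let S₂ : Set (Ideal (MvPolynomial ι R)) :=
    {P | P ∈ (fiberIdeal f ⊔ formSpan f (Ideal.span {a} * U)).minimalPrimes ∧
      P ≤ irrelevantIdeal R ι ∧ ¬ I ≤ formIdeal f P}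
  have hS₂ : S₂.Finite :=
    (Ideal.finite_minimalPrimes_of_isNoetherianRing _ _).subset fun P hP => hP.1
  obtain ⟨b, hbK, hb⟩ := exists_mem_not_span_mul_le (J := K) (U := V) (hS₂.image (formIdeal f)) (by
    rintro _ ⟨Q, ⟨hQ, hQM, hQI⟩, rfl⟩ hle
    have := hQ.1.1
    have hQf : fiberIdeal f ≤ Q := le_sup_left.trans hQ.1.2
    obtain ⟨Q', hQ', hQ'Q⟩ := Ideal.exists_minimalPrimes_le (sup_le hQf
      ((formSpan_le_iff ((ker_le_fiberIdeal f).trans hQf) hKV).2 hle))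
    have := hQ'.1.1
    have hQ'f : fiberIdeal f ≤ Q' := le_sup_left.trans hQ'.1.2
    obtain ⟨P, hP, hPQ'⟩ := Ideal.exists_minimalPrimes_le hQ'f
    have hPI : ¬ I ≤ formIdeal f P := fun hle' =>
      hQI (hle'.trans (formIdeal_mono f (hPQ'.trans hQ'Q)))
    have hlt' : P < Q' := by
      refine lt_of_le_of_ne hPQ' ?_
      rintro rfl
      exact (h P hP ((hPQ'.trans hQ'Q).trans hQM) hPI).2
        ((formSpan_le_iff ((ker_le_fiberIdeal f).trans hQ'f) hKV).1 (le_sup_right.trans hQ'.1.2))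
    have hQQ' : Q' = Q := hQ'Q.eq_of_not_lt fun hlt'' =>
      hchain hP.1.1 ‹_› ‹_› hP.1.2 hlt' hlt'' (hirr hQf hQM hQI)
    subst hQQ'
    exact ha _ ⟨Q', ⟨Or.inr hQ', hQM, hQI⟩, rfl⟩
      ((formSpan_le_iff ((ker_le_fiberIdeal f).trans hQf) haU).1 (le_sup_right.trans hQ.1.2)))
  have hbV : Ideal.span {b} * V ≤ Ideal.span (Set.range f) :=
    (Ideal.mul_mono_left ((Ideal.span_singleton_le_iff_mem _).2 hbK)).trans hKV
  refine ⟨a, haJ, b, hbK, exists_mul_pow_eq_of_forall_prime hfI (hfI ▸ sup_le haU hbV) ?_⟩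
  intro P' hP' hP'f hP'M hle
  by_contra hP'I
  have hker := (ker_le_fiberIdeal f).trans hP'f
  obtain ⟨Q, hQ, hQP'⟩ := Ideal.exists_minimalPrimes_le (sup_le hP'f
    ((formSpan_le_iff hker haU).2 (le_sup_left.trans hle)))
  have := hQ.1.1
  have hQf : fiberIdeal f ≤ Q := le_sup_left.trans hQ.1.2
  obtain ⟨P, hP, hPQ⟩ := Ideal.exists_minimalPrimes_le hQf
  have hQI : ¬ I ≤ formIdeal f Q := fun hle' => hP'I (hle'.trans (formIdeal_mono f hQP'))
  have hPI : ¬ I ≤ formIdeal f P := fun hle' => hQI (hle'.trans (formIdeal_mono f hPQ))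
  refine hchain hP.1.1 hQ.1.1 hP' hP.1.2 (lt_of_le_of_ne hPQ ?_) (lt_of_le_of_ne hQP' ?_)
    (hirr hP'f hP'M hP'I)
  · rintro rfl
    exact ha _ ⟨P, ⟨Or.inl hP, hQP'.trans hP'M, hPI⟩, rfl⟩
      ((formSpan_le_iff ((ker_le_fiberIdeal f).trans hQf) haU).1 (le_sup_right.trans hQ.1.2))
  · rintro rfl
    exact hb _ ⟨Q, ⟨hQ, hP'M, hQI⟩, rfl⟩ (le_sup_right.trans hle)

end Existence

section Order

variable {R : Type*} [CommRing R] [IsDomain R] [IsLocalRing R] {x y : R}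

theorem exists_eq_mul_pow_add_of_mem_pow_succ {R : Type*} [CommRing R] [IsLocalRing R] {x y : R}
    (hxy : maximalIdeal R = Ideal.span {x, y}) {k : ℕ} {f : R}
    (hf : f ∈ maximalIdeal R ^ (k + 1)) :
    ∃ α, ∃ g ∈ maximalIdeal R ^ k, f = α * x ^ (k + 1) + y * g := by
  rw [maximalIdeal_pow_succ (by rw [hxy, Set.pair_comm] : maximalIdeal R = Ideal.span {y, x}),
    mem_span_singleton_mul_add] at hf
  obtain ⟨g, hg, α, -, rfl⟩ := hf
  exact ⟨α, g, hg, by ring⟩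

theorem mem_pow_of_mul_mem_pow_succ (hxy : maximalIdeal R = Ideal.span {x, y}) (hy : Prime y)
    (hyx : ¬ y ∣ x) {k : ℕ} {f : R} (hf : y * f ∈ maximalIdeal R ^ (k + 1)) :
    f ∈ maximalIdeal R ^ k := by
  obtain ⟨α, g, hg, h⟩ := exists_eq_mul_pow_add_of_mem_pow_succ hxy hf
  obtain ⟨β, rfl⟩ : y ∣ α := by
    refine (hy.dvd_or_dvd (⟨f - g, by linear_combination -h⟩ : y ∣ α * x ^ (k + 1))).resolve_right ?_
    exact fun hd => hyx (hy.dvd_of_dvd_pow hd)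
  have hxm : x ∈ maximalIdeal R := hxy ▸ Ideal.subset_span (by simp)
  have h' : f = β * x ^ (k + 1) + g :=
    mul_left_cancel₀ hy.ne_zero (by linear_combination h)
  rw [h']
  exact Ideal.add_mem _ (Ideal.mul_mem_left _ _
    (Ideal.pow_le_pow_right k.le_succ (Ideal.pow_mem_pow hxm _))) hg

/-- The order function of a two-dimensional regular local ring is multiplicative. -/
theorem mem_pow_succ_or_mem_pow_succ (hxy : maximalIdeal R = Ideal.span {x, y}) (hy : Prime y)
    (hyx : ¬ y ∣ x) {p q : ℕ} {f g : R} (hf : f ∈ maximalIdeal R ^ p)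
    (hg : g ∈ maximalIdeal R ^ q) (hfg : f * g ∈ maximalIdeal R ^ (p + q + 1)) :
    f ∈ maximalIdeal R ^ (p + 1) ∨ g ∈ maximalIdeal R ^ (q + 1) := by
  have hxm : x ∈ maximalIdeal R := hxy ▸ Ideal.subset_span (by simp)
  have hym : y ∈ maximalIdeal R := hxy ▸ Ideal.subset_span (by simp)
  have hdec : ∀ {k : ℕ} {f : R}, f ∈ maximalIdeal R ^ k → ∃ α g, f = α * x ^ k + y * g := by
    rintro (_ | k) f hf
    · exact ⟨f, 0, by simp⟩
    · obtain ⟨α, g, -, h⟩ := exists_eq_mul_pow_add_of_mem_pow_succ hxy hf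
      exact ⟨α, g, h⟩
  obtain ⟨n, hn⟩ : ∃ n, n = p + q := ⟨_, rfl⟩
  induction n using Nat.strong_induction_on generalizing p q f g with
  | _ n ih =>
    subst hn
    have key : ∀ {p' q' : ℕ} {f g α h : R}, p' + q' = p + q → f ∈ maximalIdeal R ^ p' →
        g ∈ maximalIdeal R ^ q' → f * g ∈ maximalIdeal R ^ (p' + q' + 1) →
        f = α * x ^ p' + y * h → α ∈ maximalIdeal R →
        f ∈ maximalIdeal R ^ (p' + 1) ∨ g ∈ maximalIdeal R ^ (q' + 1) := by
      intro p' q' f g α h hpq hf hg hfg hα hαm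
      have hαx : α * x ^ p' ∈ maximalIdeal R ^ (p' + 1) := by
        rw [pow_succ']
        exact Ideal.mul_mem_mul hαm (Ideal.pow_mem_pow hxm _)
      rcases p' with _ | p'
      · left
        rw [hα]
        refine Ideal.add_mem _ hαx ?_
        rw [zero_add, pow_one]
        exact Ideal.mul_mem_right _ _ hym
      · have hh : h ∈ maximalIdeal R ^ p' := by
          refine mem_pow_of_mul_mem_pow_succ hxy hy hyx ?_
          have := Ideal.sub_mem _ hf (Ideal.pow_le_pow_right (Nat.le_succ _) hαx)
          rwa [hα, add_sub_cancel_left] at this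
        have hhg : h * g ∈ maximalIdeal R ^ (p' + q' + 1) := by
          refine mem_pow_of_mul_mem_pow_succ hxy hy hyx ?_
          have h1 : α * x ^ (p' + 1) * g ∈ maximalIdeal R ^ (p' + q' + 1 + 1) := by
            have := Ideal.mul_mem_mul hαx hg
            rw [← pow_add] at this
            convert this using 2
            ring
          rw [show p' + 1 + q' + 1 = p' + q' + 1 + 1 by ring] at hfg
          have := Ideal.sub_mem _ hfg h1
          rw [hα] at this
          convert this using 1
          ring
        refine (ih (p' + q') (by omega) hh hg hhg rfl).imp_left fun hh' => ?_
        rw [hα]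
        refine Ideal.add_mem _ hαx ?_
        rw [pow_succ']
        exact Ideal.mul_mem_mul hym hh'
    obtain ⟨α, h, hα⟩ := hdec hf
    obtain ⟨β, k, hβ⟩ := hdec hg
    obtain ⟨γ, l, hγ⟩ := hdec hfg
    have hd : y ∣ α * β - γ * x := by
      refine (hy.dvd_or_dvd (?_ : y ∣ x ^ (p + q) * (α * β - γ * x))).resolve_left
        fun hd => hyx (hy.dvd_of_dvd_pow hd)
      refine ⟨l - h * g - α * x ^ p * k, ?_⟩
      rw [hα, hβ] at hγ
      rw [hβ]
      linear_combination hγ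
    have hαβ : α * β ∈ maximalIdeal R := by
      obtain ⟨c, hc⟩ := hd
      rw [show α * β = γ * x + y * c by linear_combination hc]
      exact Ideal.add_mem _ (Ideal.mul_mem_left _ _ hxm) (Ideal.mul_mem_right _ _ hym)
    rcases (maximalIdeal.isMaximal R).isPrime.mem_or_mem hαβ with hm | hm
    · exact key rfl hf hg hfg hα hm
    · refine (key (add_comm q p) hg hf ?_ hβ hm).symm
      rwa [mul_comm, add_comm q]

end Order

section PowersOfMaximalIdeal

variable {R : Type*} [CommRing R] [IsDomain R] [IsLocalRing R] {x y : R} {ι : Type*}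

theorem exists_mem_map_reesHom_eq {R : Type*} [CommRing R] [IsLocalRing R] {f : ι → R} {n : ℕ}
    {g : R}
    (hg : g ∈ maximalIdeal R * Ideal.span (Set.range f) ^ n) :
    ∃ G ∈ (maximalIdeal R).map (MvPolynomial.C : R →+* MvPolynomial ι R),
      reesHom f G = Polynomial.C g * Polynomial.X ^ n := by
  induction hg using Submodule.mul_induction_on' with
  | mem_mul_mem u hu v hv =>
    obtain ⟨G, -, hG⟩ := exists_reesHom_eq_of_mem_pow hv
    refine ⟨MvPolynomial.C u * G, Ideal.mul_mem_right _ _ (Ideal.mem_map_of_mem _ hu), ?_⟩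
    rw [map_mul, hG, MvPolynomial.algHom_C, Polynomial.algebraMap_eq, map_mul, mul_assoc]
  | add u _ v _ h h' =>
    obtain ⟨G, hG, hG'⟩ := h
    obtain ⟨H, hH, hH'⟩ := h'
    exact ⟨G + H, Ideal.add_mem _ hG hH, by rw [map_add, hG', hH', map_add, add_mul]⟩

theorem mem_fiberIdeal_iff {R : Type*} [CommRing R] [IsLocalRing R] {f : ι → R} {r : ℕ}
    (hf : Ideal.span (Set.range f) = maximalIdeal R ^ r) {G : MvPolynomial ι R} :
    G ∈ fiberIdeal f ↔ ∀ n, (reesHom f G).coeff n ∈ maximalIdeal R ^ (r * n + 1) := by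
  constructor
  · intro hG
    have hW : ∀ i j, Ideal.span (Set.range f) ^ i * maximalIdeal R ^ (r * j + 1) ≤
        maximalIdeal R ^ (r * (i + j) + 1) := by
      intro i j
      rw [hf]
      exact le_of_eq (by ring)
    suffices fiberIdeal f ≤ filtrationIdeal f _ hW from this hG
    refine sup_le ?_ (Ideal.map_le_iff_le_comap.2 fun c hc n => ?_)
    · intro G hG n
      rw [(RingHom.mem_ker).1 hG, Polynomial.coeff_zero]
      exact Ideal.zero_mem _
    · rw [MvPolynomial.algHom_C, Polynomial.algebraMap_eq, Polynomial.coeff_C]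
      rcases n with _ | n
      · simpa using hc
      · simp
  · intro hG
    have h1 : ∀ n, ∃ H ∈ (maximalIdeal R).map (MvPolynomial.C : R →+* MvPolynomial ι R),
        reesHom f H = Polynomial.C ((reesHom f G).coeff n) * Polynomial.X ^ n := fun n => by
      refine exists_mem_map_reesHom_eq ?_
      rw [hf, ← pow_mul, ← pow_succ']
      exact hG n
    choose H hH hH' using h1
    have h2 : G - ∑ n ∈ Finset.range ((reesHom f G).natDegree + 1), H n ∈
        RingHom.ker (reesHom f) := by
      rw [RingHom.mem_ker, map_sub, map_sum]
      simp_rw [hH']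
      rw [← Polynomial.as_sum_range_C_mul_X_pow, sub_self]
    have h3 : ∑ n ∈ Finset.range ((reesHom f G).natDegree + 1), H n ∈
        (maximalIdeal R).map (MvPolynomial.C : R →+* MvPolynomial ι R) :=
      Ideal.sum_mem _ fun n _ => hH n
    rw [← sub_add_cancel G (∑ n ∈ Finset.range ((reesHom f G).natDegree + 1), H n)]
    exact Submodule.add_mem_sup h2 h3

/-- The fiber cone of a power of the maximal ideal is a domain. -/
theorem fiberIdeal_isPrime (hxy : maximalIdeal R = Ideal.span {x, y}) (hy : Prime y)
    (hyx : ¬ y ∣ x) {f : ι → R} {r : ℕ} (hf : Ideal.span (Set.range f) = maximalIdeal R ^ r) :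
    (fiberIdeal f).IsPrime := by
  classical
  have hmem : ∀ G n, (reesHom f G).coeff n ∈ maximalIdeal R ^ (r * n) := fun G n => by
    have := coeff_reesHom_mem f G n
    rwa [hf, ← pow_mul] at this
  refine ⟨?_, ?_⟩
  · rw [Ideal.ne_top_iff_one, mem_fiberIdeal_iff hf]
    intro h
    have := h 0
    simp only [map_one, Polynomial.coeff_one_zero, mul_zero, zero_add, pow_one] at this
    exact (Ideal.ne_top_iff_one _).1 (maximalIdeal.isMaximal R).ne_top this
  · intro F G hFG
    by_contra! hcon
    simp only [mem_fiberIdeal_iff hf, not_forall] at hcon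
    obtain ⟨hF, hG⟩ := hcon
    rw [mem_fiberIdeal_iff hf] at hFG
    set p := Nat.find hF with hp
    set q := Nat.find hG with hq
    have hlow : ∀ i < p, (reesHom f F).coeff i ∈ maximalIdeal R ^ (r * i + 1) := fun i hi =>
      not_not.1 (Nat.find_min hF hi)
    have hlow' : ∀ i < q, (reesHom f G).coeff i ∈ maximalIdeal R ^ (r * i + 1) := fun i hi =>
      not_not.1 (Nat.find_min hG hi)
    have hsum := hFG (p + q)
    rw [map_mul, Polynomial.coeff_mul,
      ← Finset.add_sum_erase _ _ (show (p, q) ∈ Finset.HasAntidiagonal.antidiagonal (p + q) by simp)] at hsum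
    have hrest : ∑ z ∈ (Finset.HasAntidiagonal.antidiagonal (p + q)).erase (p, q),
        (reesHom f F).coeff z.1 * (reesHom f G).coeff z.2 ∈
          maximalIdeal R ^ (r * (p + q) + 1) := by
      refine Ideal.sum_mem _ fun z hz => ?_
      obtain ⟨i, j⟩ := z
      simp only [Finset.mem_erase, ne_eq, Prod.mk.injEq, Finset.HasAntidiagonal.mem_antidiagonal] at hz
      obtain ⟨hne, hij⟩ := hz
      rw [← hij]
      rcases lt_or_ge i p with hi | hi
      · have := Ideal.mul_mem_mul (hlow i hi) (hmem G j)
        rw [← pow_add] at this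
        convert this using 2
        ring
      · have := Ideal.mul_mem_mul (hmem F i) (hlow' j (by omega))
        rw [← pow_add] at this
        convert this using 2
        ring
    have hprod := (Ideal.add_mem_iff_left _ hrest).1 hsum
    rw [mul_add] at hprod
    rcases mem_pow_succ_or_mem_pow_succ hxy hy hyx (hmem F p) (hmem G q) hprod with h | h
    · exact Nat.find_spec hF h
    · exact Nat.find_spec hG h

theorem mem_formIdeal_fiberIdeal_iff {R : Type*} [CommRing R] [IsLocalRing R] {f : ι → R} {r : ℕ}
    (hf : Ideal.span (Set.range f) = maximalIdeal R ^ r) {g : R} (hg : g ∈ maximalIdeal R ^ r) :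
    g ∈ formIdeal f (fiberIdeal f) ↔ g ∈ maximalIdeal R ^ (r + 1) := by
  obtain ⟨G, -, hG⟩ := exists_reesHom_eq_of_mem (f := f) (hf ▸ hg)
  rw [mem_formIdeal_iff (ker_le_fiberIdeal f) hG, mem_fiberIdeal_iff hf, hG]
  simp only [Polynomial.coeff_C_mul_X]
  constructor
  · intro h
    simpa using h 1
  · intro h n
    split_ifs with hn
    · rwa [hn, mul_one]
    · exact Ideal.zero_mem _

theorem not_mul_pow_le_pow_succ (hxy : maximalIdeal R = Ideal.span {x, y}) (hy : Prime y)
    (hyx : ¬ y ∣ x) {J : Ideal R} {s : ℕ} (hs : ordEQ J s) (t : ℕ)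
    (ht : ¬ maximalIdeal R ^ t ≤ maximalIdeal R ^ (t + 1)) :
    ¬ J * maximalIdeal R ^ t ≤ maximalIdeal R ^ (s + t + 1) := by
  intro hle
  obtain ⟨f, hf, hf'⟩ := SetLike.not_le_iff_exists.1 hs.2
  obtain ⟨g, hg, hg'⟩ := SetLike.not_le_iff_exists.1 ht
  rcases mem_pow_succ_or_mem_pow_succ hxy hy hyx (hs.1 hf) hg
    (hle (Ideal.mul_mem_mul hf hg)) with h | h
  · exact hf' h
  · exact hg' h

theorem exists_jointReduction_pow_maximalIdeal [IsNoetherianRing R] [Infinite (ResidueField R)]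
    (hdim : ringKrullDim R = 2) (hxy : maximalIdeal R = Ideal.span {x, y}) (hy : Prime y)
    (hyx : ¬ y ∣ x) {J K : Ideal R} {s t : ℕ} (hs : ordEQ J s) (ht : ordEQ K t)
    (h : J * maximalIdeal R ^ t ⊔ K * maximalIdeal R ^ s = maximalIdeal R ^ (s + t)) :
    ∃ a ∈ J, ∃ b ∈ K, ∃ n,
      (Ideal.span {a} * maximalIdeal R ^ t + Ideal.span {b} * maximalIdeal R ^ s) *
        (maximalIdeal R ^ s * maximalIdeal R ^ t) ^ n =
      (maximalIdeal R ^ s * maximalIdeal R ^ t) ^ (n + 1) := by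
  have hym : y ∈ maximalIdeal R := hxy ▸ Ideal.subset_span (by simp)
  have hpow : ∀ k, ¬ maximalIdeal R ^ k ≤ maximalIdeal R ^ (k + 1) := by
    intro k hle
    have h0 := Submodule.eq_bot_of_le_smul_of_le_jacobson_bot (maximalIdeal R) _
      (IsNoetherian.noetherian (maximalIdeal R ^ k)) (by rwa [smul_eq_mul, ← pow_succ'])
      (maximalIdeal_le_jacobson ⊥)
    have := Ideal.pow_mem_pow hym k
    rw [h0, Ideal.mem_bot] at this
    exact pow_ne_zero k hy.ne_zero this
  obtain ⟨m, f, hf⟩ := Submodule.fg_iff_exists_fin_generating_family.1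
    (IsNoetherian.noetherian (maximalIdeal R ^ (s + t)))
  change Ideal.span (Set.range f) = _ at hf
  obtain ⟨i₀, hi₀⟩ : ∃ i, f i ≠ 0 := by
    by_contra! h0
    refine hpow (s + t) (hf ▸ Ideal.span_le.2 ?_)
    rintro _ ⟨i, rfl⟩
    rw [h0]
    exact Ideal.zero_mem _
  have hprime := fiberIdeal_isPrime hxy hy hyx hf
  rw [← pow_add]
  refine exists_reduction_span_mul_add hdim hi₀ hf h fun P hP _ _ => ?_
  rw [Ideal.minimalPrimes_eq_subsingleton_self, Set.mem_singleton_iff] at hP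
  subst hP
  have hform : ∀ {L : Ideal R}, L ≤ maximalIdeal R ^ (s + t) → L ≤ formIdeal f (fiberIdeal f) →
      L ≤ maximalIdeal R ^ (s + t + 1) := fun hL hle g hg =>
    (mem_formIdeal_fiberIdeal_iff hf (hL hg)).1 (hle hg)
  constructor
  · intro hle
    exact not_mul_pow_le_pow_succ hxy hy hyx hs t (hpow t) (hform (h ▸ le_sup_left) hle)
  · intro hle
    refine not_mul_pow_le_pow_succ hxy hy hyx ht s (hpow s) ?_
    rw [add_comm t]
    exact hform (h ▸ le_sup_right) hle

theorem exists_isJointReduction [IsNoetherianRing R] [Infinite (ResidueField R)]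
    (hdim : ringKrullDim R = 2) {J K : Ideal R} (hJK : J * K ≠ ⊥) :
    ∃ a b, IsJointReduction J K a b := by
  obtain ⟨m, f, hf⟩ := Submodule.fg_iff_exists_fin_generating_family.1
    (IsNoetherian.noetherian (J * K))
  change Ideal.span (Set.range f) = _ at hf
  obtain ⟨i₀, hi₀⟩ : ∃ i, f i ≠ 0 := by
    by_contra! h0
    refine hJK (hf ▸ Ideal.span_eq_bot.2 ?_)
    rintro _ ⟨i, rfl⟩
    exact h0 i
  obtain ⟨a, ha, b, hb, n, hn⟩ := exists_reduction_span_mul_add (J := J) (U := K) (K := K) (V := J)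
    hdim hi₀ hf (by rw [mul_comm K, sup_idem]) fun P _ _ hP => ⟨hP, by rwa [mul_comm]⟩
  exact ⟨a, b, ha, hb, n, hn⟩

end PowersOfMaximalIdeal

section Main

variable {R : Type*} [CommRing R] [IsDomain R] [IsLocalRing R] [IsNoetherianRing R] {x y : R}

theorem exists_eq_add_one_of_ordEQ {R : Type*} [CommRing R] [IsLocalRing R] {J : Ideal R} {s : ℕ}
    (hJ : IsMPrimary J) (hs : ordEQ J s) : ∃ s', s = s' + 1 := by
  refine Nat.exists_eq_add_one.2 (Nat.pos_of_ne_zero ?_)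
  rintro rfl
  refine hs.2 ?_
  rw [zero_add, pow_one]
  exact Ideal.le_radical.trans (le_of_eq hJ)

theorem IsJointReduction.le_radical {R : Type*} [CommRing R] [IsLocalRing R] {J K : Ideal R}
    {a b : R} (hJ : IsMPrimary J) (hK : IsMPrimary K) (hab : IsJointReduction J K a b) :
    maximalIdeal R ≤ (Ideal.span {a, b}).radical := by
  obtain ⟨-, -, n, hn⟩ := hab
  exact le_radical_of_jointReduction (le_of_eq hJ.symm) (le_of_eq hK.symm) hn

theorem colength_span_mul_add_of_isJointReduction (hxy : maximalIdeal R = Ideal.span {x, y})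
    (hy : Prime y) (hyx : ¬ y ∣ x) {J K : Ideal R} {a b : R} (hJ : IsMPrimary J)
    (hK : IsMPrimary K) (hab : IsJointReduction J K a b) :
    colength (Ideal.span {a} * K + Ideal.span {b} * J) =
      colength (Ideal.span {a, b}) + colength K + colength J :=
  (onlyKoszulRelations_of_le_radical hxy hy hyx (hab.le_radical hJ hK)).colength_eq hab.2.1 hab.1

theorem colength_span_mul_pow_add_of_isJointReduction (hxy : maximalIdeal R = Ideal.span {x, y})
    (hy : Prime y) (hyx : ¬ y ∣ x) {J K : Ideal R} {a b : R} (hJ : IsMPrimary J)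
    (hK : IsMPrimary K) {s t : ℕ} (hs : J ≤ maximalIdeal R ^ (s + 1))
    (ht : K ≤ maximalIdeal R ^ (t + 1)) (hab : IsJointReduction J K a b) :
    colength (Ideal.span {a} * maximalIdeal R ^ t + Ideal.span {b} * maximalIdeal R ^ s) =
      colength (Ideal.span {a, b}) + colength (maximalIdeal R ^ t) +
        colength (maximalIdeal R ^ s) :=
  (onlyKoszulRelations_of_le_radical hxy hy hyx (hab.le_radical hJ hK)).colength_eq
    (Ideal.pow_le_pow_right t.le_succ (ht hab.2.1)) (Ideal.pow_le_pow_right s.le_succ (hs hab.1))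

theorem span_mul_pow_add_le {R : Type*} [CommRing R] [IsLocalRing R] {J K : Ideal R} {s t : ℕ}
    (hs : J ≤ maximalIdeal R ^ (s + 1)) (ht : K ≤ maximalIdeal R ^ (t + 1)) :
    maximalIdeal R ^ t * J + maximalIdeal R ^ s * K ≤ maximalIdeal R ^ (s + t + 1) := by
  refine sup_le ((Ideal.mul_mono_right hs).trans (le_of_eq ?_))
    ((Ideal.mul_mono_right ht).trans (le_of_eq ?_)) <;>
  ring

theorem span_mul_add_span_mul_le {R : Type*} [CommRing R] {J K U V : Ideal R} {a b : R}
    (ha : a ∈ J) (hb : b ∈ K) :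
    Ideal.span {a} * U + Ideal.span {b} * V ≤ U * J + V * K := by
  rw [mul_comm U, mul_comm V]
  exact sup_le_sup (Ideal.mul_mono_left ((Ideal.span_singleton_le_iff_mem _).2 ha))
    (Ideal.mul_mono_left ((Ideal.span_singleton_le_iff_mem _).2 hb))

/-- If `J 𝔪 ^ t + K 𝔪 ^ s = 𝔪 ^ (s + t)`, then a joint reduction of `(J, K)` has colength at
most `s t`. -/
theorem colength_span_pair_le_mul [Infinite (ResidueField R)] (hdim : ringKrullDim R = 2)
    (hxy : maximalIdeal R = Ideal.span {x, y}) (hy : Prime y) (hyx : ¬ y ∣ x) {J K : Ideal R}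
    {s t : ℕ} (hJ : IsMPrimary J) (hK : IsMPrimary K) (hs : ordEQ J (s + 1))
    (ht : ordEQ K (t + 1))
    (h : maximalIdeal R ^ (s + t + 1) = maximalIdeal R ^ t * J + maximalIdeal R ^ s * K)
    {a b : R} (hab : IsJointReduction J K a b) :
    colength (Ideal.span {a, b}) ≤ ((s + 1) * (t + 1) : ℕ) := by
  have hxm : x ∈ maximalIdeal R := hxy ▸ Ideal.subset_span (by simp)
  have hym : y ∈ maximalIdeal R := hxy ▸ Ideal.subset_span (by simp)
  have hrad : ∀ k, maximalIdeal R ≤ (maximalIdeal R ^ (k + 1)).radical := fun k => by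
    rw [Ideal.radical_pow _ k.succ_ne_zero]
    exact Ideal.le_radical
  have h' : J * maximalIdeal R ^ (t + 1) ⊔ K * maximalIdeal R ^ (s + 1) =
      maximalIdeal R ^ (s + 1 + (t + 1)) := by
    rw [show s + 1 + (t + 1) = s + t + 1 + 1 by ring, pow_succ _ (s + t + 1), h]
    change J * maximalIdeal R ^ (t + 1) + K * maximalIdeal R ^ (s + 1) = _
    ring
  obtain ⟨a', ha', b', hb', n, hn⟩ :=
    exists_jointReduction_pow_maximalIdeal hdim hxy hy hyx hs ht h'
  have hrad' := le_radical_of_jointReduction (hrad s) (hrad t) hn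
  obtain ⟨ha, hb, m, hm⟩ := hab
  calc colength (Ideal.span {a, b}) ≤ colength (Ideal.span {a', b'}) :=
        colength_span_pair_le_of_jointReduction hxy hy hyx (le_of_eq hJ.symm) (le_of_eq hK.symm)
          ha hb hm ha' hb' hrad'
    _ ≤ colength (Ideal.span {x ^ (s + 1), y ^ (t + 1)}) :=
        colength_span_pair_le_of_jointReduction hxy hy hyx (hrad s) (hrad t)
          (hs.1 ha') (ht.1 hb') hn (Ideal.pow_mem_pow hxm _) (Ideal.pow_mem_pow hym _)
          (le_radical_span_pow_pow (hxy ▸ Ideal.le_radical) _ _)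
    _ = ((s + 1) * (t + 1) : ℕ) := by rw [colength_span_params hxy hy hyx, Nat.cast_mul]

theorem colength_eq_and_maximalIdeal_pow_eq_iff [Infinite (ResidueField R)]
    (hdim : ringKrullDim R = 2)
    (hxy : maximalIdeal R = Ideal.span {x, y}) (hy : Prime y) (hyx : ¬ y ∣ x) {J K : Ideal R}
    {s t : ℕ} (hJ : IsMPrimary J) (hK : IsMPrimary K) (hs : ordEQ J (s + 1))
    (ht : ordEQ K (t + 1)) :
    (colength (J * K) = colength J + colength K + ((s + 1) * (t + 1) : ℕ) ∧
      maximalIdeal R ^ (s + t + 1) = maximalIdeal R ^ t * J + maximalIdeal R ^ s * K) ↔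
    (∀ a b : R, IsJointReduction J K a b →
      J * K = Ideal.span {a} * K + Ideal.span {b} * J ∧
      maximalIdeal R ^ (s + t + 1) =
        Ideal.span {a} * maximalIdeal R ^ t + Ideal.span {b} * maximalIdeal R ^ s) := by
  have hJtop : colength J ≠ ⊤ := colength_ne_top_of_le_radical hxy hy hyx (le_of_eq hJ.symm)
  have hKtop : colength K ≠ ⊤ := colength_ne_top_of_le_radical hxy hy hyx (le_of_eq hK.symm)
  have hpow := colength_maximalIdeal_pow_add hxy hy hyx s t
  have hst : colength (maximalIdeal R ^ (s + t + 1)) ≠ ⊤ :=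
    colength_maximalIdeal_pow_ne_top hxy hy hyx _
  constructor
  · rintro ⟨h1, h2⟩ a b hab
    have hE := colength_span_pair_le_mul hdim hxy hy hyx hJ hK hs ht h2 hab
    constructor
    · refine (eq_of_le_of_colength_le ?_ ?_ ?_).symm
      · refine (span_mul_add_span_mul_le hab.1 hab.2.1).trans (le_of_eq ?_)
        rw [mul_comm K J]
        exact sup_idem _
      · rw [h1]
        exact WithTop.add_ne_top.2 ⟨WithTop.add_ne_top.2 ⟨hJtop, hKtop⟩, ENat.natCast_ne_top _⟩
      · rw [h1, colength_span_mul_add_of_isJointReduction hxy hy hyx hJ hK hab, add_assoc,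
          add_comm (colength K), add_comm _ ((_ : ℕ) : ℕ∞)]
        gcongr
    · refine (eq_of_le_of_colength_le ((span_mul_add_span_mul_le hab.1 hab.2.1).trans
        (span_mul_pow_add_le hs.1 ht.1)) hst ?_).symm
      rw [colength_span_mul_pow_add_of_isJointReduction hxy hy hyx hJ hK hs.1 ht.1 hab, hpow,
        add_assoc, add_assoc, add_comm (colength (maximalIdeal R ^ t))]
      gcongr
      exact_mod_cast hE
  · intro h
    have hne : ∀ {L : Ideal R}, IsMPrimary L → L ≠ ⊥ := by
      rintro _ hL rfl
      have hbot : maximalIdeal R = ⊥ := by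
        rw [← hL]
        exact Ideal.isRadical_bot.radical
      exact maximalIdeal_ne_bot_of_ringKrullDim_eq_two hdim hbot
    obtain ⟨a, b, hab⟩ := exists_isJointReduction hdim (mul_ne_zero (hne hJ) (hne hK))
    obtain ⟨h1, h2⟩ := h a b hab
    have hE : colength (Ideal.span {a, b}) = ((s + 1) * (t + 1) : ℕ) := by
      have h3 := colength_span_mul_pow_add_of_isJointReduction hxy hy hyx hJ hK hs.1 ht.1 hab
      rw [← h2, hpow, add_assoc, add_assoc, add_comm (colength (maximalIdeal R ^ t))] at h3
      push_cast
      refine (WithTop.add_right_cancel ?_ h3).symm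
      exact WithTop.add_ne_top.2 ⟨colength_maximalIdeal_pow_ne_top hxy hy hyx _,
        colength_maximalIdeal_pow_ne_top hxy hy hyx _⟩
    constructor
    · rw [h1, colength_span_mul_add_of_isJointReduction hxy hy hyx hJ hK hab, hE]
      ring
    · refine le_antisymm ?_ (span_mul_pow_add_le hs.1 ht.1)
      exact h2.le.trans (span_mul_add_span_mul_le hab.1 hab.2.1)

end Main

/-- for integrally closed `𝔪`-primary ideals `J, K` of orders `s, t` with
`I = JK` of order `r = s + t`, the conditions
(1)(a) `λ(R/JK) = λ(R/J) + λ(R/K) + st`, (1)(b) `𝔪^(r-1) = 𝔪^(t-1) J + 𝔪^(s-1) K`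
hold iff for every joint reduction `a, b` of `J, K` one has
(2)(a) `JK = aK + bJ` and (2)(b) `𝔪^(r-1) = a𝔪^(t-1) + b𝔪^(s-1)`. -/
theorem statement13 (R : Type*) [CommRing R] [IsLocalRing R]
    (hreg : IsTwoDimRegularLocal R) [Infinite (IsLocalRing.ResidueField R)]
    (J K : Ideal R) (hJc : IdealIntClosed J) (hJp : IsMPrimary J)
    (hKc : IdealIntClosed K) (hKp : IsMPrimary K)
    (s t : ℕ) (hs : ordEQ J s) (ht : ordEQ K t) :
    (modLength R (R ⧸ (J * K)) =
        modLength R (R ⧸ J) + modLength R (R ⧸ K) + ((s * t : ℕ) : WithBot ℕ∞) ∧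
      maximalIdeal R ^ (s + t - 1) =
        maximalIdeal R ^ (t - 1) * J + maximalIdeal R ^ (s - 1) * K) ↔
    (∀ a b : R, IsJointReduction J K a b →
      J * K = Ideal.span {a} * K + Ideal.span {b} * J ∧
      maximalIdeal R ^ (s + t - 1) =
        Ideal.span {a} * maximalIdeal R ^ (t - 1) +
          Ideal.span {b} * maximalIdeal R ^ (s - 1)) := by
  obtain ⟨_, x, y, hxy, hy, hyx⟩ := isDomain_and_exists_params hreg
  have := hreg.1
  obtain ⟨s, rfl⟩ := exists_eq_add_one_of_ordEQ hJp hs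
  obtain ⟨t, rfl⟩ := exists_eq_add_one_of_ordEQ hKp ht
  rw [show s + 1 + (t + 1) - 1 = s + t + 1 by omega, Nat.add_sub_cancel, Nat.add_sub_cancel,
    ← colength_eq_and_maximalIdeal_pow_eq_iff hreg.2.1 hxy hy hyx hJp hKp hs ht,
    modLength_quotient_eq, modLength_quotient_eq, modLength_quotient_eq]
  norm_cast
end
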